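/- arXiv:math/0405410 — 4 statements merged into one kernel-verified Lean document; each statement's English description precedes it below -/
import Mathlib

section
/- Let 0 < r < 1 < R be fixed and let u_1, …, u_N be nonnegative reals with ∑_{k=1}^N u_k = 1 such that the greatest common divisor of the set of indices k with u_k > 0 equals 1. Then for every x ∈ ℓ_{1,R} there exists a unique z ∈ ℓ_{1,r} satisfying z_n = x_n + ∑_{k=1}^{min(N,n)} u_k z_{n−k} for all n ≥ 0. Moreover, there is a sequence (C_n) of nonnegative reals tending to 0, depending only on r, R and the u_k (not on x), such that |z_n − ω/J| ≤ ‖x‖_{ℓ_{1,R}} · C_n for all n ≥ 0, where ω = ∑_{k=0}^∞ x_k and J = ∑_{k=1}^N k u_k. -/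
open Filter

theorem renewal_greatest (N : ℕ) (u T w : ℕ → ℝ) (B c lam : ℝ)
    (hu_nonneg : ∀ k ∈ Finset.Icc 1 N, 0 ≤ u k)
    (hu_sum : ∑ k ∈ Finset.Icc 1 N, u k = 1)
    (hu_gcd : ((Finset.Icc 1 N).filter (fun k => 0 < u k)).gcd id = 1)
    (hB : ∀ n, w n ∈ Set.Icc (-B) B)
    (hrec : ∀ n, N + 1 ≤ n → w n = ∑ k ∈ Finset.Icc 1 N, u k * w (n - k))
    (hinv : ∀ n, N ≤ n → ∑ j ∈ Finset.range N, T j * w (n - j) = c)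
    (hlam : IsGreatest {y | MapClusterPt y atTop w} lam) :
    lam * ∑ j ∈ Finset.range N, T j = c := by
  have key : ∀ d ∈ AddSubmonoid.closure
      (((Finset.Icc 1 N).filter (fun k => 0 < u k) : Finset ℕ) : Set ℕ),
      ∀ U : Ultrafilter ℕ, (U : Filter ℕ) ≤ atTop → Tendsto w U (nhds lam) →
        Tendsto (fun n => w (n - d)) U (nhds lam) := by
    intro d hd
    induction hd using AddSubmonoid.closure_induction with
    | mem k hk =>
      intro U hU hw
      rw [Finset.mem_coe, Finset.mem_filter] at hk
      have h1 : ∀ j : ℕ, ∃ y, Tendsto (fun n => w (n - j)) U (nhds y) ∧ y ≤ lam := by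
        intro j
        have hle : ((U.map (fun n => n - j) : Ultrafilter ℕ) : Filter ℕ) ≤ atTop :=
          (tendsto_sub_atTop_nat j).mono_left hU
        obtain ⟨y, -, hy⟩ := (isCompact_Icc (a := -B) (b := B)).ultrafilter_le_nhds
          (U.map (fun n : ℕ => w (n - j)))
          (by
            rw [le_principal_iff]
            exact Filter.mem_map.2 (Filter.univ_mem' (fun n : ℕ => hB (n - j))))
        refine ⟨y, hy, hlam.2 ?_⟩
        exact mapClusterPt_iff_ultrafilter.2 ⟨_, hle, hy⟩
      choose y hy hyl using h1
      have h2 : Tendsto (fun n => ∑ k ∈ Finset.Icc 1 N, u k * w (n - k)) U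
          (nhds (∑ k ∈ Finset.Icc 1 N, u k * y k)) :=
        tendsto_finsetSum _ fun i _ => (hy i).const_mul _
      have h3 : lam = ∑ k ∈ Finset.Icc 1 N, u k * y k := by
        refine tendsto_nhds_unique (hw.congr' ?_) h2
        filter_upwards [hU (eventually_ge_atTop (N + 1))] with n hn using hrec n hn
      have h4 : ∑ k ∈ Finset.Icc 1 N, u k * (lam - y k) = 0 := by
        simp only [mul_sub, Finset.sum_sub_distrib, ← Finset.sum_mul, hu_sum]
        linarith
      have h5 := (Finset.sum_eq_zero_iff_of_nonneg (fun i hi =>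
        mul_nonneg (hu_nonneg i hi) (sub_nonneg.2 (hyl i)))).1 h4 k hk.1
      have h6 : y k = lam := by
        rcases mul_eq_zero.1 h5 with h | h
        · exact absurd h hk.2.ne'
        · linarith
      rw [← h6]; exact hy k
    | zero => intro U _ hw; simpa using hw
    | add a b _ _ ha hb =>
      intro U hU hw
      have hle : ((U.map (fun n => n - a) : Ultrafilter ℕ) : Filter ℕ) ≤ atTop :=
          (tendsto_sub_atTop_nat a).mono_left hU
      have := hb (U.map (fun n => n - a)) hle (ha U hU hw)
      have h' : Tendsto (fun n => w (n - a - b)) U (nhds lam) := this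
      simpa [Nat.sub_sub] using h'
  obtain ⟨L, hL⟩ := Nat.exists_mem_closure_of_ge
    (((Finset.Icc 1 N).filter (fun k => 0 < u k) : Finset ℕ) : Set ℕ)
  have hg : Nat.setGcd (((Finset.Icc 1 N).filter (fun k => 0 < u k) : Finset ℕ) : Set ℕ) ∣ 1 := by
    refine dvd_trans ?_ (dvd_of_eq hu_gcd)
    exact Finset.dvd_gcd fun b hb => Nat.setGcd_dvd_of_mem (Finset.mem_coe.2 hb)
  obtain ⟨U, hU, hw⟩ := mapClusterPt_iff_ultrafilter.1 hlam.1
  have h1 : Tendsto (fun n => ∑ j ∈ Finset.range N, T j * w (n - L - j)) U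
      (nhds (∑ j ∈ Finset.range N, T j * lam)) := by
    refine tendsto_finsetSum _ fun j _ => Tendsto.const_mul _ ?_
    have := key (L + j) (hL _ (by omega) (hg.trans (one_dvd _))) U hU hw
    simpa [Nat.sub_sub] using this
  have h2 : Tendsto (fun n => ∑ j ∈ Finset.range N, T j * w (n - L - j)) U (nhds c) := by
    refine tendsto_const_nhds.congr' ?_
    filter_upwards [hU (eventually_ge_atTop (N + L))] with n hn
    exact (hinv (n - L) (by omega)).symm
  rw [mul_comm, Finset.sum_mul]
  exact tendsto_nhds_unique h1 h2

theorem exists_greatest (w : ℕ → ℝ) (B : ℝ) (hB : ∀ n, w n ∈ Set.Icc (-B) B) :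
    ∃ lam, IsGreatest {y | MapClusterPt y atTop w} lam := by
  have hc : IsCompact {y | MapClusterPt y atTop w} := by
    refine (isCompact_Icc (a := -B) (b := B)).of_isClosed_subset isClosed_setOfPred_clusterPt ?_
    intro y hy
    exact isClosed_Icc.mem_of_mapClusterPt hy (Eventually.of_forall hB)
  refine hc.exists_isGreatest ?_
  obtain ⟨y, -, hy⟩ := (isCompact_Icc (a := -B) (b := B)).exists_mapClusterPt
    (f := atTop) (u := w) (le_principal_iff.2 (Eventually.of_forall hB : ∀ᶠ n in atTop, w n ∈ Set.Icc (-B) B))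
  exact ⟨y, hy⟩

theorem renewal_tendsto (N : ℕ) (u T w : ℕ → ℝ) (B c J : ℝ)
    (hu_nonneg : ∀ k ∈ Finset.Icc 1 N, 0 ≤ u k)
    (hu_sum : ∑ k ∈ Finset.Icc 1 N, u k = 1)
    (hu_gcd : ((Finset.Icc 1 N).filter (fun k => 0 < u k)).gcd id = 1)
    (hB : ∀ n, w n ∈ Set.Icc (-B) B)
    (hrec : ∀ n, N + 1 ≤ n → w n = ∑ k ∈ Finset.Icc 1 N, u k * w (n - k))
    (hinv : ∀ n, N ≤ n → ∑ j ∈ Finset.range N, T j * w (n - j) = c)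
    (hJ : ∑ j ∈ Finset.range N, T j = J) (hJ0 : 0 < J) :
    Tendsto w atTop (nhds (c / J)) := by
  have hB' : ∀ n, (fun n => - w n) n ∈ Set.Icc (-B) B := fun n =>
    ⟨by linarith [(hB n).2], by linarith [(hB n).1]⟩
  obtain ⟨a, ha⟩ := exists_greatest w B hB
  obtain ⟨b, hb⟩ := exists_greatest (fun n => - w n) B hB'
  have e1 := renewal_greatest N u T w B c a hu_nonneg hu_sum hu_gcd hB hrec hinv ha
  have e2 := renewal_greatest N u T (fun n => - w n) B (-c) b hu_nonneg hu_sum hu_gcd hB'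
    (fun n hn => by simp [hrec n hn]) (fun n hn => by simp [← hinv n hn]) hb
  rw [hJ] at e1 e2
  refine (isCompact_Icc (a := -B) (b := B)).tendsto_nhds_of_unique_mapClusterPt
    (Eventually.of_forall hB) ?_
  intro y _ hy
  have h1 : y ≤ a := ha.2 hy
  have h2 : -y ≤ b := by
    apply hb.2
    obtain ⟨U, hU, hw⟩ := mapClusterPt_iff_ultrafilter.1 hy
    exact mapClusterPt_iff_ultrafilter.2 ⟨U, hU, hw.neg⟩
  rw [eq_div_iff hJ0.ne']
  nlinarith

theorem renewal_exists (N : ℕ) (u : ℕ → ℝ)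
    (hu_nonneg : ∀ k ∈ Finset.Icc 1 N, 0 ≤ u k)
    (hu_sum : ∑ k ∈ Finset.Icc 1 N, u k = 1)
    (hu_gcd : ((Finset.Icc 1 N).filter (fun k => 0 < u k)).gcd id = 1) :
    ∃ v : ℕ → ℝ, (∀ n, 0 ≤ v n ∧ v n ≤ 1) ∧
      Tendsto v atTop (nhds (1 / ∑ k ∈ Finset.Icc 1 N, (k : ℝ) * u k)) ∧
      ∀ x z : ℕ → ℝ, (∀ n : ℕ, z n = x n + ∑ k ∈ Finset.Icc 1 (min N n), u k * z (n - k)) ↔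
        ∀ n, z n = ∑ m ∈ Finset.range (n + 1), x m * v (n - m) := by
  classical
  let a : ℕ → ℝ := fun k => if k ∈ Finset.Icc 1 N then u k else 0
  let A : PowerSeries ℝ := PowerSeries.mk a
  have hA : ∀ (Z : PowerSeries ℝ) n, PowerSeries.coeff n (A * Z) =
      ∑ k ∈ Finset.Icc 1 (min N n), u k * PowerSeries.coeff (n - k) Z := by
    intro Z n
    rw [PowerSeries.coeff_mul, Finset.Nat.sum_antidiagonal_eq_sum_range_succ_mk]
    symm
    apply Finset.sum_subset_zero_on_sdiff
    · intro k hk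
      simp only [Finset.mem_Icc, Finset.mem_range] at *
      omega
    · intro k hk
      simp only [Finset.mem_sdiff, Finset.mem_Icc, Finset.mem_range] at hk
      have : k ∉ Finset.Icc 1 N := by rw [Finset.mem_Icc]; omega
      simp only [A, PowerSeries.coeff_mk, a, if_neg this, zero_mul]
    · intro k hk
      have : k ∈ Finset.Icc 1 N := by rw [Finset.mem_Icc] at *; omega
      simp only [A, PowerSeries.coeff_mk, a, if_pos this]
  have hunit : PowerSeries.constantCoeff (1 - A) ≠ 0 := by
    have : PowerSeries.constantCoeff A = 0 := by
      rw [← PowerSeries.coeff_zero_eq_constantCoeff_apply]; simp [A, a]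
    simp [this]
  let V : PowerSeries ℝ := (1 - A)⁻¹
  have hV : (1 - A) * V = 1 := PowerSeries.mul_inv_cancel _ hunit
  let v : ℕ → ℝ := fun n => PowerSeries.coeff n V
  have hVA : V = 1 + A * V := by linear_combination hV
  have hv : ∀ n, v n = (if n = 0 then 1 else 0) +
      ∑ k ∈ Finset.Icc 1 (min N n), u k * v (n - k) := by
    intro n
    have := congrArg (PowerSeries.coeff n) hVA
    rw [map_add, hA, PowerSeries.coeff_one] at this
    exact this
  have hv01 : ∀ n, 0 ≤ v n ∧ v n ≤ 1 := by
    intro n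
    induction n using Nat.strong_induction_on with
    | _ n ih =>
      rcases Nat.eq_zero_or_pos n with rfl | hn
      · rw [hv]; simp
      · rw [hv, if_neg hn.ne', zero_add]
        have hmem : ∀ k ∈ Finset.Icc 1 (min N n), k ∈ Finset.Icc 1 N ∧ n - k < n := by
          intro k hk; rw [Finset.mem_Icc] at *; omega
        constructor
        · exact Finset.sum_nonneg fun k hk =>
            mul_nonneg (hu_nonneg k (hmem k hk).1) (ih _ (hmem k hk).2).1
        · calc ∑ k ∈ Finset.Icc 1 (min N n), u k * v (n - k)
              ≤ ∑ k ∈ Finset.Icc 1 (min N n), u k := Finset.sum_le_sum fun k hk =>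
                mul_le_of_le_one_right (hu_nonneg k (hmem k hk).1) (ih _ (hmem k hk).2).2
            _ ≤ ∑ k ∈ Finset.Icc 1 N, u k :=
                Finset.sum_le_sum_of_subset_of_nonneg (fun k hk => (hmem k hk).1)
                  fun k hk _ => hu_nonneg k hk
            _ = 1 := hu_sum
  let T : ℕ → ℝ := fun n => PowerSeries.coeff n ((1 - A) * PowerSeries.mk 1)
  have hT : ∀ n, T n = ∑ k ∈ Finset.Icc 1 N, if n < k then u k else 0 := by
    intro n
    have h1 : T n = 1 - ∑ k ∈ Finset.Icc 1 (min N n), u k := by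
      simp only [T, sub_mul, one_mul, map_sub, hA]
      simp
    rw [h1, ← hu_sum, sub_eq_iff_eq_add, ← Finset.sum_filter]
    rw [show Finset.Icc 1 (min N n) = (Finset.Icc 1 N).filter (fun k => ¬ n < k) by
      ext k; simp only [Finset.mem_Icc, Finset.mem_filter]; omega]
    exact (Finset.sum_filter_add_sum_filter_not _ _ _).symm
  have hT0 : ∀ n, N ≤ n → T n = 0 := by
    intro n hn
    rw [hT]
    refine Finset.sum_eq_zero fun k hk => if_neg ?_
    rw [Finset.mem_Icc] at hk; omega
  have hTJ : ∑ j ∈ Finset.range N, T j = ∑ k ∈ Finset.Icc 1 N, (k : ℝ) * u k := by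
    simp only [hT]
    rw [Finset.sum_comm]
    refine Finset.sum_congr rfl fun k hk => ?_
    rw [← Finset.sum_filter, show (Finset.range N).filter (fun j => j < k) = Finset.range k by
      ext j; rw [Finset.mem_Icc] at hk; simp only [Finset.mem_range, Finset.mem_filter]; omega]
    simp
  have hJ0 : 0 < ∑ k ∈ Finset.Icc 1 N, (k : ℝ) * u k := by
    have : (1 : ℝ) ≤ ∑ k ∈ Finset.Icc 1 N, (k : ℝ) * u k := by
      rw [← hu_sum]
      refine Finset.sum_le_sum fun k hk => le_mul_of_one_le_left (hu_nonneg k hk) ?_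
      exact_mod_cast (Finset.mem_Icc.1 hk).1
    linarith
  have hTV : ((1 - A) * PowerSeries.mk 1) * V = PowerSeries.mk 1 := by
    linear_combination (PowerSeries.mk 1) * hV
  refine ⟨v, hv01, ?_, ?_⟩
  · refine renewal_tendsto N u T v 1 1 _ hu_nonneg hu_sum hu_gcd
      (fun n => ⟨by linarith [(hv01 n).1], (hv01 n).2⟩) ?_ ?_ hTJ hJ0
    · intro n hn
      rw [hv, if_neg (by omega), zero_add, min_eq_left (by omega)]
    · intro n hn
      have := congrArg (PowerSeries.coeff n) hTV
      rw [PowerSeries.coeff_mul, Finset.Nat.sum_antidiagonal_eq_sum_range_succ_mk] at this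
      simp only [PowerSeries.coeff_mk, Pi.one_apply] at this
      rw [← this]
      apply Finset.sum_subset_zero_on_sdiff
      · intro k hk
        simp only [Finset.mem_range] at *
        omega
      · intro k hk
        simp only [Finset.mem_sdiff, Finset.mem_range] at hk
        have h0 := hT0 k (by omega)
        simp only [T] at h0
        rw [h0, zero_mul]
      · intro k hk; rfl
  · intro x z
    have e1 : (∀ n : ℕ, z n = x n + ∑ k ∈ Finset.Icc 1 (min N n), u k * z (n - k)) ↔
        PowerSeries.mk z = PowerSeries.mk x + A * PowerSeries.mk z := by
      rw [PowerSeries.ext_iff]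
      simp only [map_add, hA, PowerSeries.coeff_mk]
    have e2 : (∀ n, z n = ∑ m ∈ Finset.range (n + 1), x m * v (n - m)) ↔
        PowerSeries.mk z = PowerSeries.mk x * V := by
      rw [PowerSeries.ext_iff]
      simp only [PowerSeries.coeff_mul, Finset.Nat.sum_antidiagonal_eq_sum_range_succ_mk,
        PowerSeries.coeff_mk]
      rfl
    rw [e1, e2]
    constructor
    · intro h
      linear_combination V * h - PowerSeries.mk z * hV
    · intro h
      rw [h]
      linear_combination PowerSeries.mk x * hV




/-- Lemma A.0 / renewal lemma for sequences.
`ℓ_{1,r}` membership is expressed by summability of `fun n => r ^ n * |x n|`, and the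
corresponding norm is the value of that sum. -/
theorem stmt_0
    (r R : ℝ) (hr0 : 0 < r) (hr1 : r < 1) (hR : 1 < R)
    (N : ℕ) (u : ℕ → ℝ)
    (hu_nonneg : ∀ k ∈ Finset.Icc 1 N, 0 ≤ u k)
    (hu_sum : ∑ k ∈ Finset.Icc 1 N, u k = 1)
    (hu_gcd : ((Finset.Icc 1 N).filter (fun k => 0 < u k)).gcd id = 1) :
    ∃ C : ℕ → ℝ, (∀ n, 0 ≤ C n) ∧ Tendsto C atTop (nhds 0) ∧
      ∀ x : ℕ → ℝ, Summable (fun n => R ^ n * |x n|) →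
        (∃! z : ℕ → ℝ, Summable (fun n => r ^ n * |z n|) ∧
            ∀ n : ℕ, z n = x n + ∑ k ∈ Finset.Icc 1 (min N n), u k * z (n - k)) ∧
        (∀ z : ℕ → ℝ,
          (Summable (fun n => r ^ n * |z n|) ∧
            ∀ n : ℕ, z n = x n + ∑ k ∈ Finset.Icc 1 (min N n), u k * z (n - k)) →
          ∀ n : ℕ,
            |z n - (∑' k : ℕ, x k) / (∑ k ∈ Finset.Icc 1 N, (k : ℝ) * u k)| ≤
              (∑' m : ℕ, R ^ m * |x m|) * C n) := by
  obtain ⟨v, hv01, hvlim, hsol⟩ := renewal_exists N u hu_nonneg hu_sum hu_gcd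
  set J : ℝ := ∑ k ∈ Finset.Icc 1 N, (k : ℝ) * u k with hJdef
  have hJ1 : (1 : ℝ) ≤ J := by
    rw [hJdef, ← hu_sum]
    refine Finset.sum_le_sum fun k hk => le_mul_of_one_le_left (hu_nonneg k hk) ?_
    exact_mod_cast (Finset.mem_Icc.1 hk).1
  have hJi : 0 ≤ 1 / J ∧ 1 / J ≤ 1 := ⟨by positivity, by
    rw [div_le_one (by linarith)]; exact hJ1⟩
  -- the kernel extended by zero to negative indices
  let g : ℕ → ℕ → ℝ := fun n m => (if m ≤ n then v (n - m) else 0) - 1 / J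
  have hg1 : ∀ n m, |g n m| ≤ 1 := by
    intro n m
    simp only [g]
    rw [abs_le]
    split_ifs
    · constructor <;> linarith [(hv01 (n - m)).1, (hv01 (n - m)).2, hJi.1, hJi.2]
    · constructor <;> linarith [hJi.1, hJi.2]
  have hR0 : 0 < R := by linarith
  have hsumR : Summable (fun m : ℕ => (R⁻¹) ^ m) :=
    summable_geometric_of_lt_one (by positivity) (inv_lt_one_of_one_lt₀ hR)
  have hpos : ∀ n m, 0 ≤ (R⁻¹) ^ m * |g n m| := fun n m => by positivity
  have hle : ∀ n m, (R⁻¹) ^ m * |g n m| ≤ (R⁻¹) ^ m := fun n m =>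
    mul_le_of_le_one_right (by positivity) (hg1 n m)
  have hsg : ∀ n, Summable (fun m => (R⁻¹) ^ m * |g n m|) := fun n =>
    Summable.of_nonneg_of_le (hpos n) (hle n) hsumR
  refine ⟨fun n => ∑' m, (R⁻¹) ^ m * |g n m|, fun n => tsum_nonneg (hpos n), ?_, ?_⟩
  · have := tendsto_tsum_of_dominated_convergence (𝓕 := atTop)
      (f := fun n m => (R⁻¹) ^ m * |g n m|) (g := fun _ => (0 : ℝ)) hsumR ?_ ?_
    · simpa using this
    · intro m
      have h1 : Tendsto (fun n => g n m) atTop (nhds 0) := by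
        have h2 : Tendsto (fun n => v (n - m) - 1 / J) atTop (nhds (1 / J - 1 / J)) :=
          (hvlim.comp (tendsto_sub_atTop_nat m)).sub_const _
        rw [sub_self] at h2
        refine h2.congr' ?_
        filter_upwards [eventually_ge_atTop m] with n hn
        simp only [g, if_pos hn]
      simpa using h1.abs.const_mul ((R⁻¹) ^ m)
    · refine Eventually.of_forall fun n m => ?_
      rw [Real.norm_of_nonneg (hpos n m)]
      exact hle n m
  · intro x hx
    have hxabs : Summable (fun n => |x n|) :=
      Summable.of_nonneg_of_le (fun n => abs_nonneg _)
        (fun n => le_mul_of_one_le_left (abs_nonneg _) (one_le_pow₀ hR.le)) hx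
    have hxs : Summable x := hxabs.of_abs
    refine ⟨?_, ?_⟩
    · refine ⟨fun n => ∑ m ∈ Finset.range (n + 1), x m * v (n - m), ⟨?_, ?_⟩, ?_⟩
      · refine Summable.of_nonneg_of_le (fun n => by positivity) (fun n => ?_)
          ((summable_geometric_of_lt_one hr0.le hr1).mul_right (∑' m, |x m|))
        refine mul_le_mul_of_nonneg_left ?_ (by positivity)
        calc |∑ m ∈ Finset.range (n + 1), x m * v (n - m)|
            ≤ ∑ m ∈ Finset.range (n + 1), |x m * v (n - m)| := Finset.abs_sum_le_sum_abs _ _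
          _ ≤ ∑ m ∈ Finset.range (n + 1), |x m| := Finset.sum_le_sum fun m _ => by
              rw [abs_mul, abs_of_nonneg (hv01 (n - m)).1]
              exact mul_le_of_le_one_right (abs_nonneg _) (hv01 _).2
          _ ≤ ∑' m, |x m| := hxabs.sum_le_tsum _ fun m _ => abs_nonneg _
      · exact (hsol x _).2 fun n => rfl
      · rintro z ⟨-, hz⟩
        funext n
        exact (hsol x z).1 hz n
    · rintro z ⟨-, hz⟩ n
      have hzn := (hsol x z).1 hz n
      have hz2 : z n = ∑' m, x m * (if m ≤ n then v (n - m) else 0) := by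
        rw [tsum_eq_sum (s := Finset.range (n + 1)), hzn]
        · refine Finset.sum_congr rfl fun m hm => ?_
          rw [if_pos (by rw [Finset.mem_range] at hm; omega)]
        · intro m hm
          rw [if_neg (by rw [Finset.mem_range] at hm; omega), mul_zero]
      have hs1 : Summable (fun m => x m * (if m ≤ n then v (n - m) else 0)) := by
        apply summable_of_ne_finset_zero (s := Finset.range (n + 1))
        intro m hm
        rw [if_neg (by rw [Finset.mem_range] at hm; omega), mul_zero]
      have hdiff : z n - (∑' k, x k) / J = ∑' m, x m * g n m := by
        rw [hz2, div_eq_mul_one_div, ← tsum_mul_right, ← hs1.tsum_sub (hxs.mul_right _)]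
        refine tsum_congr fun m => ?_
        simp only [g]; ring
      have hterm : ∀ m, |x m * g n m| ≤ (∑' m, R ^ m * |x m|) * ((R⁻¹) ^ m * |g n m|) := by
        intro m
        have h1 : R ^ m * |x m| ≤ ∑' m, R ^ m * |x m| :=
          hx.le_tsum m fun j _ => by positivity
        calc |x m * g n m| = (R ^ m * |x m|) * ((R⁻¹) ^ m * |g n m|) := by
              rw [abs_mul, inv_pow]; field_simp
          _ ≤ _ := mul_le_mul_of_nonneg_right h1 (hpos n m)
      have hS := (hsg n).mul_left (∑' m, R ^ m * |x m|)
      rw [hdiff, ← tsum_mul_left]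
      have hsa : Summable (fun m => |x m * g n m|) :=
        Summable.of_nonneg_of_le (fun m => abs_nonneg _) hterm hS
      have h1 : |∑' m, x m * g n m| ≤ ∑' m, |x m * g n m| := by
        have := norm_tsum_le_tsum_norm (f := fun m => x m * g n m) (by simpa using hsa)
        simpa [Real.norm_eq_abs] using this
      exact h1.trans (hsa.tsum_le_tsum hterm hS)
end

section
/- Let 0 < r < 1 < R be fixed, and let u_1,…,u_N and v_1,…,v_N be nonnegative reals with ∑_{k=1}^N (u_k + v_k) = 1 and ∑_{k=1}^N v_k > 0, such that the greatest common divisor of the set of indices k with u_k + v_k > 0 equals 1, and such that there exists either an odd k ≤ N with u_k > 0 or an even k ≤ N with v_k > 0. Then for every pair x_1, x_2 ∈ ℓ_{1,R} there exists a unique pair z_1, z_2 ∈ ℓ_{1,r} satisfying, for j = 1, 2 and all n ≥ 0, z_{j,n} = x_{j,n} + ∑_{k=1}^{min(N,n)} (u_k z_{j,n−k} + v_k z_{3−j,n−k}). Moreover, there is a sequence (C_n) of nonnegative reals tending to 0, depending only on r, R, the u_k and the v_k (not on x_1, x_2), such that for j = 1, 2 and all n ≥ 0, |z_{j,n} − ω/J|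 ≤ (‖x_1‖_{ℓ_{1,R}} + ‖x_2‖_{ℓ_{1,R}}) · C_n, where ω = (1/2) ∑_{k=0}^∞ (x_{1,k} + x_{2,k}) and J = ∑_{k=1}^N k (u_k + v_k). -/
open Filter

section helpers
open PowerSeries

lemma aux_mul_sum (F G : PowerSeries ℂ) (hF : Summable (fun n => ‖coeff n F‖))
    (hG : Summable (fun n => ‖coeff n G‖)) : Summable (fun n => ‖coeff n (F * G)‖) := by
  have := summable_norm_sum_mul_antidiagonal_of_summable_norm hF hG
  simpa [PowerSeries.coeff_mul] using this

lemma aux_tsum_mul (F G : PowerSeries ℂ) (hF : Summable (fun n => ‖coeff n F‖))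
    (hG : Summable (fun n => ‖coeff n G‖)) :
    ∑' n, coeff n (F * G) = (∑' n, coeff n F) * ∑' n, coeff n G := by
  rw [tsum_mul_tsum_eq_tsum_sum_antidiagonal_of_summable_norm hF hG]
  simp [PowerSeries.coeff_mul]

lemma aux_lin (a : ℂ) (ha : 1 < ‖a‖) : ∃ G : PowerSeries ℂ,
    Summable (fun n => ‖coeff n G‖) ∧
      ((Polynomial.X - Polynomial.C a : Polynomial ℂ) : PowerSeries ℂ) * G = 1 := by
  have ha0 : a ≠ 0 := by
    rintro rfl
    simp at ha
    linarith
  refine ⟨PowerSeries.mk (fun n => - (a⁻¹) ^ (n + 1)), ?_, ?_⟩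
  · have h1 : ‖a⁻¹‖ < 1 := by
      rw [norm_inv]; exact inv_lt_one_of_one_lt₀ ha
    have := (summable_geometric_of_lt_one (norm_nonneg _) h1)
    have := (summable_nat_add_iff 1).2 this
    simpa [norm_pow] using this
  · ext n
    rcases n with _ | n
    · simp [sub_mul, ha0, coeff_zero_X_mul]
    · simp only [Polynomial.coe_sub, Polynomial.coe_X, Polynomial.coe_C, sub_mul, map_sub,
        coeff_succ_X_mul, coeff_mk, coeff_C_mul, coeff_one]
      simp
      field_simp
      ring

lemma aux_prod (s : Multiset ℂ) : (∀ a ∈ s, 1 < ‖a‖) → ∃ G : PowerSeries ℂ,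
    Summable (fun n => ‖coeff n G‖) ∧
      (((s.map (fun a => Polynomial.X - Polynomial.C a)).prod : Polynomial ℂ) : PowerSeries ℂ)
        * G = 1 := by
  induction s using Multiset.induction_on with
  | empty =>
    intro _
    refine ⟨1, ?_, by simp⟩
    apply summable_of_finite_support
    apply (Set.finite_singleton 0).subset
    intro n hn
    by_contra h
    simp [coeff_one] at hn h
    exact h hn
  | cons a s ih =>
    intro h
    obtain ⟨G, hG, hG1⟩ := ih (fun b hb => h b (Multiset.mem_cons_of_mem hb))
    obtain ⟨F, hF, hF1⟩ := aux_lin a (h a (Multiset.mem_cons_self a s))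
    refine ⟨F * G, aux_mul_sum _ _ hF hG, ?_⟩
    rw [Multiset.map_cons, Multiset.prod_cons, Polynomial.coe_mul, mul_mul_mul_comm, hF1, hG1,
      one_mul]

lemma aux_poly_summable (P : Polynomial ℂ) :
    Summable (fun n => ‖coeff n (P : PowerSeries ℂ)‖) := by
  apply summable_of_finite_support
  apply (P.support.finite_toSet).subset
  intro n hn
  simpa using hn

lemma aux_poly_tsum (P : Polynomial ℂ) :
    ∑' n, coeff n (P : PowerSeries ℂ) = P.eval 1 := by
  rw [Polynomial.eval_eq_sum, Polynomial.sum, tsum_eq_sum (s := P.support)]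
  · simp
  · intro n hn
    simpa using hn

lemma aux_inv (P : Polynomial ℂ) (h : ∀ w : ℂ, ‖w‖ ≤ 1 → P.eval w ≠ 0) :
    ∃ G : PowerSeries ℂ, Summable (fun n => ‖coeff n G‖) ∧ (P : PowerSeries ℂ) * G = 1 ∧
      ∑' n, coeff n G = (P.eval 1)⁻¹ := by
  have hP : P ≠ 0 := by
    rintro rfl
    exact h 0 (by simp) (by simp)
  have key : ∃ G : PowerSeries ℂ, Summable (fun n => ‖coeff n G‖) ∧
      (P : PowerSeries ℂ) * G = 1 := by
    obtain ⟨G, hG, hG1⟩ := aux_prod P.roots (by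
      intro a ha
      by_contra hc
      exact h a (not_lt.1 hc) (Polynomial.isRoot_of_mem_roots ha))
    have hl : P.leadingCoeff ≠ 0 := by simpa using hP
    refine ⟨PowerSeries.C (P.leadingCoeff⁻¹) * G, ?_, ?_⟩
    · simpa using hG.mul_left (‖P.leadingCoeff‖⁻¹)
    · have := (IsAlgClosed.splits P).eq_prod_roots
      have h2 := congrArg (fun Q : Polynomial ℂ => (Q : PowerSeries ℂ)) this
      simp only [Polynomial.coe_mul, Polynomial.coe_C] at h2
      rw [h2, mul_mul_mul_comm, hG1, ← map_mul, mul_inv_cancel₀ hl]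
      simp
  obtain ⟨G, hG, hG1⟩ := key
  refine ⟨G, hG, hG1, ?_⟩
  have := aux_tsum_mul _ _ (aux_poly_summable P) hG
  rw [hG1, aux_poly_tsum] at this
  have h1 : ∑' n, coeff n (1 : PowerSeries ℂ) = 1 := by
    have := aux_poly_tsum 1
    simpa using this
  rw [h1] at this
  exact eq_inv_of_mul_eq_one_right this.symm

/-- The convolution kernel. -/
noncomputable def auxK (G : PowerSeries ℂ) (ρ : ℝ) (m : ℕ) : ℝ :=
  ∑ p ∈ Finset.HasAntidiagonal.antidiagonal m, ‖coeff p.1 G‖ * ρ ^ p.2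

lemma auxK_nonneg (G : PowerSeries ℂ) (ρ : ℝ) (h0 : 0 ≤ ρ) (m : ℕ) : 0 ≤ auxK G ρ m :=
  Finset.sum_nonneg fun _ _ => by positivity

lemma auxK_summable (G : PowerSeries ℂ) (hG : Summable (fun n => ‖coeff n G‖))
    (ρ : ℝ) (h0 : 0 ≤ ρ) (h1 : ρ < 1) : Summable (auxK G ρ) := by
  have h2 : Summable (fun n : ℕ => ‖ρ ^ n‖) := by
    simpa [abs_of_nonneg h0] using summable_geometric_of_lt_one h0 h1
  have h3 : Summable (fun n => ‖(‖coeff n G‖)‖) := by simpa using hG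
  exact (summable_norm_sum_mul_antidiagonal_of_summable_norm h3 h2).of_norm

lemma auxK_bound (G : PowerSeries ℂ) (ρ M : ℝ) (x : ℕ → ℂ)
    (hx : ∀ n, ‖x n‖ ≤ M * ρ ^ n) (m : ℕ) : ‖coeff m (G * mk x)‖ ≤ M * auxK G ρ m := by
  rw [coeff_mul, auxK, Finset.mul_sum]
  refine (norm_sum_le _ _).trans (Finset.sum_le_sum fun p _ => ?_)
  rw [norm_mul, coeff_mk]
  calc _ ≤ ‖coeff p.1 G‖ * (M * ρ ^ p.2) := by gcongr; exact hx _
    _ = _ := by ring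

lemma aux_s (H : Polynomial ℂ) (G : PowerSeries ℂ) (hG : Summable (fun n => ‖coeff n G‖))
    (hHG : (H : PowerSeries ℂ) * G = 1) (hG1 : ∑' n, coeff n G = (H.eval 1)⁻¹)
    (ρ M : ℝ) (h0 : 0 ≤ ρ) (h1 : ρ < 1) (x z : ℕ → ℂ)
    (hx : ∀ n, ‖x n‖ ≤ M * ρ ^ n)
    (hz : (1 - X) * (H : PowerSeries ℂ) * mk z = mk x) (n : ℕ) :
    ‖z n - (∑' k, x k) / H.eval 1‖ ≤ M * ∑' m, auxK G ρ (m + (n + 1)) := by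
  have hxs : Summable (fun n => ‖x n‖) :=
    Summable.of_nonneg_of_le (fun _ => norm_nonneg _) hx
      ((summable_geometric_of_lt_one h0 h1).mul_left M)
  have e1 : (1 - X) * mk z = G * mk x := by
    rw [← hz]
    calc _ = (1 - X) * ((H : PowerSeries ℂ) * G) * mk z := by rw [hHG, mul_one]
      _ = _ := by ring
  have e2 : ∀ n, z n = ∑ m ∈ Finset.range (n + 1), coeff m (G * mk x) := by
    intro n
    rw [← e1]
    induction n with
    | zero => simp [sub_mul, coeff_zero_X_mul]
    | succ n ih =>
      rw [Finset.sum_range_succ, ← ih]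
      simp [sub_mul, coeff_succ_X_mul]
  have hsum : Summable (fun n => ‖coeff n (G * mk x)‖) :=
    aux_mul_sum _ _ hG (by simpa using hxs)
  have e3 : ∑' n, coeff n (G * mk x) = (∑' k, x k) / H.eval 1 := by
    rw [aux_tsum_mul _ _ hG (by simpa using hxs), hG1]
    simp [div_eq_mul_inv, mul_comm]
  have e4 := hsum.of_norm.sum_add_tsum_nat_add (n + 1)
  rw [e2, ← e3, ← e4, sub_add_cancel_left, norm_neg, ← tsum_mul_left]
  have hs2 := (summable_nat_add_iff (n + 1)).2 hsum
  refine (norm_tsum_le_tsum_norm hs2).trans (Summable.tsum_le_tsum (fun m => auxK_bound _ _ _ _ hx _) hs2 ?_)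
  exact ((summable_nat_add_iff (n + 1)).2 (auxK_summable G hG ρ h0 h1)).mul_left M

lemma aux_d (H : Polynomial ℂ) (G : PowerSeries ℂ)
    (hHG : (H : PowerSeries ℂ) * G = 1) (ρ M : ℝ) (x z : ℕ → ℂ)
    (hx : ∀ n, ‖x n‖ ≤ M * ρ ^ n)
    (hz : (H : PowerSeries ℂ) * mk z = mk x) (n : ℕ) :
    ‖z n‖ ≤ M * auxK G ρ n := by
  have e1 : mk z = G * mk x := by
    rw [← hz, ← mul_assoc, mul_comm G, hHG, one_mul]
  have : z n = coeff n (G * mk x) := by rw [← e1, coeff_mk]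
  rw [this]
  exact auxK_bound _ _ _ _ hx _

/-- recurrence versus power series -/
lemma aux_rec {K : Type*} [Field K] (N : ℕ) (a z x : ℕ → K) :
    (∀ n, z n = x n + ∑ k ∈ Finset.Icc 1 (min N n), a k * z (n - k)) ↔
    (1 - ∑ k ∈ Finset.Icc 1 N, PowerSeries.C (a k) * X ^ k) * mk z = mk x := by
  rw [PowerSeries.ext_iff]
  refine forall_congr' fun n => ?_
  have : ∑ k ∈ Finset.Icc 1 (min N n), a k * z (n - k)
      = ∑ k ∈ Finset.Icc 1 N, if k ≤ n then a k * z (n - k) else 0 := by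
    rw [← Finset.sum_filter]
    congr 1
    ext k
    simp
    tauto
  rw [this, sub_mul, one_mul, map_sub, Finset.sum_mul, map_sum, coeff_mk, coeff_mk, sub_eq_iff_eq_add]
  have : ∀ k, coeff n (PowerSeries.C (a k) * X ^ k * mk z) = if k ≤ n then a k * z (n - k) else 0 := by
    intro k
    rw [mul_assoc, coeff_C_mul, coeff_X_pow_mul']
    simp
  simp only [this]

lemma aux_solve (N : ℕ) (a x : ℕ → ℝ) :
    ∃ z : ℕ → ℝ, ∀ n, z n = x n + ∑ k ∈ Finset.Icc 1 (min N n), a k * z (n - k) := by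
  set A : PowerSeries ℝ := 1 - ∑ k ∈ Finset.Icc 1 N, PowerSeries.C (a k) * X ^ k with hA
  refine ⟨fun n => coeff n (A⁻¹ * mk x), ?_⟩
  rw [aux_rec, ← hA]
  have h : constantCoeff A ≠ 0 := by
    rw [hA, map_sub, map_sum, Finset.sum_eq_zero]
    · simp
    · intro k hk
      have : k ≠ 0 := by simp at hk; omega
      simp [this]
  have : (mk fun n => coeff n (A⁻¹ * mk x)) = A⁻¹ * mk x := by ext; simp
  rw [this, ← mul_assoc, PowerSeries.mul_inv_cancel _ h, one_mul]

lemma aux_pow_eq (w : ℂ) (hw : ‖w‖ ≤ 1) (h : w.re = 1) : w = 1 := by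
  have h1 : ‖w‖ ^ 2 ≤ 1 := by nlinarith [norm_nonneg w]
  rw [← Complex.normSq_eq_norm_sq, Complex.normSq_apply, h] at h1
  have : w.im = 0 := by nlinarith
  apply Complex.ext <;> simp [h, this]

lemma aux_unit (N : ℕ) (u v : ℕ → ℝ)
    (hu : ∀ k ∈ Finset.Icc 1 N, 0 ≤ u k) (hv : ∀ k ∈ Finset.Icc 1 N, 0 ≤ v k)
    (huv : ∑ k ∈ Finset.Icc 1 N, (u k + v k) = 1) (w : ℂ) (hw : ‖w‖ ≤ 1)
    (h : ∑ k ∈ Finset.Icc 1 N, ((u k - v k : ℝ) : ℂ) * w ^ k = 1) :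
    ∀ k ∈ Finset.Icc 1 N, (0 < u k → w ^ k = 1) ∧ (0 < v k → w ^ k = -1) := by
  have hre := congrArg Complex.re h
  rw [Complex.re_sum] at hre
  simp only [Complex.re_ofReal_mul, Complex.one_re] at hre
  have hn : ∀ k, ‖w ^ k‖ ≤ 1 := fun k => by rw [norm_pow]; exact pow_le_one₀ (norm_nonneg _) hw
  have hb : ∀ k, |(w ^ k).re| ≤ 1 := fun k => (Complex.abs_re_le_norm _).trans (hn k)
  have hz : ∑ k ∈ Finset.Icc 1 N, (u k * (1 - (w ^ k).re) + v k * (1 + (w ^ k).re)) = 0 := by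
    have : ∀ k, u k * (1 - (w ^ k).re) + v k * (1 + (w ^ k).re)
      = (u k + v k) - (u k - v k) * (w ^ k).re := fun k => by ring
    simp only [this]
    rw [Finset.sum_sub_distrib, huv, hre, sub_self]
  rw [Finset.sum_eq_zero_iff_of_nonneg] at hz
  · intro k hk
    have h1 := hz k hk
    have h2 := abs_le.1 (hb k)
    have p1 : 0 ≤ u k * (1 - (w ^ k).re) := mul_nonneg (hu k hk) (by linarith)
    have p2 : 0 ≤ v k * (1 + (w ^ k).re) := mul_nonneg (hv k hk) (by linarith)
    constructor
    · intro hp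
      have : u k * (1 - (w ^ k).re) = 0 := by linarith
      have := (mul_eq_zero.1 this).resolve_left hp.ne'
      exact aux_pow_eq _ (hn k) (by linarith)
    · intro hp
      have : v k * (1 + (w ^ k).re) = 0 := by linarith
      have := (mul_eq_zero.1 this).resolve_left hp.ne'
      have := aux_pow_eq (-(w ^ k)) (by rw [norm_neg]; exact hn k) (by rw [Complex.neg_re]; linarith)
      rw [← this, neg_neg]
  · intro k hk
    have h2 := abs_le.1 (hb k)
    exact add_nonneg (mul_nonneg (hu k hk) (by linarith)) (mul_nonneg (hv k hk) (by linarith))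

lemma aux_gcd (s : Finset ℕ) (hs : s.gcd id = 1) (w : ℂ) (h : ∀ k ∈ s, w ^ k = 1) : w = 1 := by
  have : orderOf w ∣ s.gcd id := Finset.dvd_gcd fun k hk => orderOf_dvd_of_pow_eq_one (h k hk)
  rw [hs, Nat.dvd_one, orderOf_eq_one_iff] at this
  exact this

lemma pow_eq_one_iff_cases_aux (w : ℂ) (h : w ^ 2 = 1) : w = 1 ∨ w = -1 := by
  rw [← sq_eq_sq_iff_eq_or_eq_neg]
  simpa using h

lemma aux_main
    (R : ℝ) (hR : 1 < R)
    (N : ℕ) (u v : ℕ → ℝ)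
    (hu_nonneg : ∀ k ∈ Finset.Icc 1 N, 0 ≤ u k)
    (hv_nonneg : ∀ k ∈ Finset.Icc 1 N, 0 ≤ v k)
    (huv_sum : ∑ k ∈ Finset.Icc 1 N, (u k + v k) = 1)
    (hv_pos : 0 < ∑ k ∈ Finset.Icc 1 N, v k)
    (huv_gcd : ((Finset.Icc 1 N).filter (fun k => 0 < u k + v k)).gcd id = 1)
    (hparity : ∃ k ∈ Finset.Icc 1 N, (Odd k ∧ 0 < u k) ∨ (Even k ∧ 0 < v k)) :
    ∃ C : ℕ → ℝ, (∀ n, 0 ≤ C n) ∧ Tendsto C atTop (nhds 0) ∧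
      ∀ (M : ℝ) (x s y d : ℕ → ℝ), (∀ n, |x n| ≤ M * R⁻¹ ^ n) → (∀ n, |y n| ≤ M * R⁻¹ ^ n) →
        (∀ n, s n = x n + ∑ k ∈ Finset.Icc 1 (min N n), (u k + v k) * s (n - k)) →
        (∀ n, d n = y n + ∑ k ∈ Finset.Icc 1 (min N n), (u k - v k) * d (n - k)) →
        ∀ n, |s n - (∑' k, x k) / (∑ k ∈ Finset.Icc 1 N, (k : ℝ) * (u k + v k))| ≤ M * C n ∧
          |d n| ≤ M * C n := by
  have hR0 : 0 ≤ R⁻¹ := by positivity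
  have hR1 : R⁻¹ < 1 := inv_lt_one_of_one_lt₀ hR
  -- J positive
  have hJ : 0 < ∑ k ∈ Finset.Icc 1 N, (k : ℝ) * (u k + v k) := by
    have : ∑ k ∈ Finset.Icc 1 N, (u k + v k) ≤ ∑ k ∈ Finset.Icc 1 N, (k : ℝ) * (u k + v k) := by
      refine Finset.sum_le_sum fun k hk => ?_
      have h1 : (1 : ℝ) ≤ k := by exact_mod_cast (Finset.mem_Icc.1 hk).1
      have := hu_nonneg k hk
      have := hv_nonneg k hk
      nlinarith
    linarith
  let H : Polynomial ℂ := ∑ k ∈ Finset.Icc 1 N,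
    Polynomial.C ((u k + v k : ℝ) : ℂ) * ∑ i ∈ Finset.range k, Polynomial.X ^ i
  have hH : (1 - Polynomial.X) * H
      = 1 - ∑ k ∈ Finset.Icc 1 N, Polynomial.C ((u k + v k : ℝ) : ℂ) * Polynomial.X ^ k := by
    have h1 : (1 : Polynomial ℂ) = ∑ k ∈ Finset.Icc 1 N, Polynomial.C ((u k + v k : ℝ) : ℂ) := by
      rw [← map_sum, ← Complex.ofReal_sum, huv_sum]; simp
    conv_rhs => rw [h1]
    rw [← Finset.sum_sub_distrib, Finset.mul_sum]
    refine Finset.sum_congr rfl fun k _ => ?_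
    rw [mul_left_comm, mul_neg_geom_sum]
    ring
  have hH1 : H.eval 1 = ((∑ k ∈ Finset.Icc 1 N, (k : ℝ) * (u k + v k) : ℝ) : ℂ) := by
    simp [H, Polynomial.eval_finsetSum, mul_comm]
  have hHroot : ∀ w : ℂ, ‖w‖ ≤ 1 → H.eval w ≠ 0 := by
    intro w hw h0
    have h2 := congrArg (Polynomial.eval w) hH
    rw [Polynomial.eval_mul, h0, mul_zero] at h2
    simp only [Polynomial.eval_sub, Polynomial.eval_one, Polynomial.eval_finsetSum,
      Polynomial.eval_mul, Polynomial.eval_C, Polynomial.eval_pow, Polynomial.eval_X] at h2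
    have h3 := aux_unit N (fun k => u k + v k) (fun _ => 0)
      (fun k hk => add_nonneg (hu_nonneg k hk) (hv_nonneg k hk)) (by simp) (by simpa using huv_sum)
      w hw (by simpa using (sub_eq_zero.1 h2.symm).symm)
    have hw1 : w = 1 := aux_gcd _ huv_gcd w (by
      intro k hk
      rw [Finset.mem_filter] at hk
      exact (h3 k hk.1).1 hk.2)
    rw [hw1, hH1] at h0
    exact hJ.ne' (by exact_mod_cast h0)
  let B : Polynomial ℂ :=
    1 - ∑ k ∈ Finset.Icc 1 N, Polynomial.C ((u k - v k : ℝ) : ℂ) * Polynomial.X ^ k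
  have hBroot : ∀ w : ℂ, ‖w‖ ≤ 1 → B.eval w ≠ 0 := by
    intro w hw h2
    simp only [B, Polynomial.eval_sub, Polynomial.eval_one, Polynomial.eval_finsetSum,
      Polynomial.eval_mul, Polynomial.eval_C, Polynomial.eval_pow, Polynomial.eval_X] at h2
    have h3 := aux_unit N u v hu_nonneg hv_nonneg huv_sum w hw (sub_eq_zero.1 h2).symm
    have hw1 : w ^ 2 = 1 := aux_gcd _ huv_gcd (w ^ 2) (by
      intro k hk
      rw [Finset.mem_filter] at hk
      rw [← pow_mul, mul_comm, pow_mul]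
      by_cases hp : 0 < u k
      · rw [(h3 k hk.1).1 hp]; simp
      · have hp2 : 0 < v k := by linarith [hk.2]
        rw [(h3 k hk.1).2 hp2]; simp)
    rcases (pow_eq_one_iff_cases_aux w hw1) with rfl | rfl
    · obtain ⟨k, hk, hk2⟩ : ∃ k ∈ Finset.Icc 1 N, 0 < v k := by
        by_contra! hc
        exact absurd hv_pos (not_lt.2 (Finset.sum_nonpos hc))
      have := (h3 k hk).2 hk2
      norm_num at this
    · obtain ⟨k, hk, ⟨ho, hp⟩ | ⟨he, hp⟩⟩ := hparity
      · have := (h3 k hk).1 hp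
        rw [ho.neg_one_pow] at this
        norm_num at this
      · have := (h3 k hk).2 hp
        rw [he.neg_one_pow] at this
        norm_num at this
  obtain ⟨G, hG, hHG, hGs⟩ := aux_inv H hHroot
  obtain ⟨F, hF, hBF, -⟩ := aux_inv B hBroot
  have hKG := auxK_summable G hG _ hR0 hR1
  have hKF := auxK_summable F hF _ hR0 hR1
  have n1 : ∀ n, 0 ≤ ∑' m, auxK G R⁻¹ (m + (n + 1)) := fun n =>
    tsum_nonneg fun m => auxK_nonneg _ _ hR0 _
  have n2 : ∀ n, 0 ≤ auxK F R⁻¹ n := fun n => auxK_nonneg _ _ hR0 _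
  refine ⟨fun n => (∑' m, auxK G R⁻¹ (m + (n + 1))) + auxK F R⁻¹ n,
    fun n => add_nonneg (n1 n) (n2 n), ?_, ?_⟩
  · have t1 := (tendsto_add_atTop_iff_nat 1).2 (tendsto_sum_nat_add (auxK G R⁻¹))
    simpa using t1.add hKF.tendsto_atTop_zero
  · intro M x s y d hx hy hs hd n
    have hM : 0 ≤ M := by simpa using (abs_nonneg _).trans (hx 0)
    have hs' : ∀ n, ((s n : ℝ) : ℂ) = (x n : ℂ) +
        ∑ k ∈ Finset.Icc 1 (min N n), ((u k + v k : ℝ) : ℂ) * ((s (n - k) : ℝ) : ℂ) := fun n => by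
      rw [hs n]; push_cast; rfl
    have hd' : ∀ n, ((d n : ℝ) : ℂ) = (y n : ℂ) +
        ∑ k ∈ Finset.Icc 1 (min N n), ((u k - v k : ℝ) : ℂ) * ((d (n - k) : ℝ) : ℂ) := fun n => by
      rw [hd n]; push_cast; rfl
    have es := (aux_rec N (fun k => ((u k + v k : ℝ) : ℂ)) (fun n => (s n : ℂ))
      (fun n => (x n : ℂ))).1 hs'
    have ed := (aux_rec N (fun k => ((u k - v k : ℝ) : ℂ)) (fun n => (d n : ℂ))
      (fun n => (y n : ℂ))).1 hd'
    have cA : (1 - X) * (H : PowerSeries ℂ)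
        = 1 - ∑ k ∈ Finset.Icc 1 N, PowerSeries.C ((u k + v k : ℝ) : ℂ) * X ^ k := by
      have := congrArg (Polynomial.coeToPowerSeries.ringHom (R := ℂ)) hH
      simpa only [map_mul, map_sub, map_one, map_sum, map_pow,
        Polynomial.coeToPowerSeries.ringHom_apply, Polynomial.coe_X, Polynomial.coe_C] using this
    have cB : (B : PowerSeries ℂ)
        = 1 - ∑ k ∈ Finset.Icc 1 N, PowerSeries.C ((u k - v k : ℝ) : ℂ) * X ^ k := by
      rw [← Polynomial.coeToPowerSeries.ringHom_apply]
      simp only [B, map_mul, map_sub, map_one, map_sum, map_pow,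
        Polynomial.coeToPowerSeries.ringHom_apply, Polynomial.coe_X, Polynomial.coe_C]
    have b1 := aux_s H G hG hHG hGs R⁻¹ M hR0 hR1 (fun n => (x n : ℂ)) (fun n => (s n : ℂ))
      (fun n => by simpa using hx n) (by rw [cA]; exact es) n
    have b2 := aux_d B F hBF R⁻¹ M (fun n => (y n : ℂ)) (fun n => (d n : ℂ))
      (fun n => by simpa using hy n) (by rw [cB]; exact ed) n
    rw [hH1, ← Complex.ofReal_tsum, ← Complex.ofReal_div, ← Complex.ofReal_sub,
      Complex.norm_real, Real.norm_eq_abs] at b1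
    rw [Complex.norm_real, Real.norm_eq_abs] at b2
    have := mul_nonneg hM (n1 n)
    have := mul_nonneg hM (n2 n)
    constructor <;> rw [mul_add] <;> linarith

lemma aux_pt (R : ℝ) (hR : 1 < R) (x : ℕ → ℝ) (hx : Summable (fun n => R ^ n * |x n|)) (n : ℕ) :
    |x n| ≤ (∑' m, R ^ m * |x m|) * R⁻¹ ^ n := by
  have hp : 0 < R ^ n := by positivity
  have := hx.le_tsum n (fun m _ => by positivity)
  rw [inv_pow, ← div_eq_mul_inv, le_div_iff₀ hp]
  linarith

end helpers

/-- two-component renewal lemma for sequences.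
`ℓ_{1,r}` membership is expressed by summability of `fun n => r ^ n * |x n|`, and the
corresponding norm is the value of that sum.  The pair `(z₁, z₂)` plays the role of
`(z_1, z_2)`, and `z_{3-j}` is the other component. -/
theorem stmt_1
    (r R : ℝ) (hr0 : 0 < r) (hr1 : r < 1) (hR : 1 < R)
    (N : ℕ) (u v : ℕ → ℝ)
    (hu_nonneg : ∀ k ∈ Finset.Icc 1 N, 0 ≤ u k)
    (hv_nonneg : ∀ k ∈ Finset.Icc 1 N, 0 ≤ v k)
    (huv_sum : ∑ k ∈ Finset.Icc 1 N, (u k + v k) = 1)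
    (hv_pos : 0 < ∑ k ∈ Finset.Icc 1 N, v k)
    (huv_gcd : ((Finset.Icc 1 N).filter (fun k => 0 < u k + v k)).gcd id = 1)
    (hparity : ∃ k ∈ Finset.Icc 1 N, (Odd k ∧ 0 < u k) ∨ (Even k ∧ 0 < v k)) :
    ∃ C : ℕ → ℝ, (∀ n, 0 ≤ C n) ∧ Tendsto C atTop (nhds 0) ∧
      ∀ x₁ x₂ : ℕ → ℝ, Summable (fun n => R ^ n * |x₁ n|) →
        Summable (fun n => R ^ n * |x₂ n|) →
        (∃! zp : (ℕ → ℝ) × (ℕ → ℝ),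
            (Summable (fun n => r ^ n * |zp.1 n|) ∧ Summable (fun n => r ^ n * |zp.2 n|)) ∧
            ∀ n : ℕ,
              zp.1 n = x₁ n +
                  ∑ k ∈ Finset.Icc 1 (min N n), (u k * zp.1 (n - k) + v k * zp.2 (n - k)) ∧
              zp.2 n = x₂ n +
                  ∑ k ∈ Finset.Icc 1 (min N n), (u k * zp.2 (n - k) + v k * zp.1 (n - k))) ∧
        (∀ z₁ z₂ : ℕ → ℝ,
          Summable (fun n => r ^ n * |z₁ n|) → Summable (fun n => r ^ n * |z₂ n|) →
          (∀ n : ℕ,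
              z₁ n = x₁ n +
                  ∑ k ∈ Finset.Icc 1 (min N n), (u k * z₁ (n - k) + v k * z₂ (n - k)) ∧
              z₂ n = x₂ n +
                  ∑ k ∈ Finset.Icc 1 (min N n), (u k * z₂ (n - k) + v k * z₁ (n - k))) →
          ∀ n : ℕ,
            |z₁ n - ((1 / 2) * ∑' k : ℕ, (x₁ k + x₂ k)) /
                (∑ k ∈ Finset.Icc 1 N, (k : ℝ) * (u k + v k))| ≤
              ((∑' m : ℕ, R ^ m * |x₁ m|) + ∑' m : ℕ, R ^ m * |x₂ m|) * C n ∧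
            |z₂ n - ((1 / 2) * ∑' k : ℕ, (x₁ k + x₂ k)) /
                (∑ k ∈ Finset.Icc 1 N, (k : ℝ) * (u k + v k))| ≤
              ((∑' m : ℕ, R ^ m * |x₁ m|) + ∑' m : ℕ, R ^ m * |x₂ m|) * C n) := by
  obtain ⟨C, hC0, hCt, hC⟩ := aux_main R hR N u v hu_nonneg hv_nonneg huv_sum hv_pos huv_gcd hparity
  refine ⟨C, hC0, hCt, ?_⟩
  intro x₁ x₂ hx₁ hx₂
  have p₁ := aux_pt R hR x₁ hx₁
  have p₂ := aux_pt R hR x₂ hx₂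
  set M := (∑' m : ℕ, R ^ m * |x₁ m|) + ∑' m : ℕ, R ^ m * |x₂ m| with hM
  set J := ∑ k ∈ Finset.Icc 1 N, (k : ℝ) * (u k + v k) with hJ
  have q₁ : ∀ n, |x₁ n + x₂ n| ≤ M * R⁻¹ ^ n := fun n => by
    rw [hM, add_mul]
    exact (abs_add_le _ _).trans (add_le_add (p₁ n) (p₂ n))
  have q₂ : ∀ n, |x₁ n - x₂ n| ≤ M * R⁻¹ ^ n := fun n => by
    rw [hM, add_mul]
    exact (abs_sub _ _).trans (add_le_add (p₁ n) (p₂ n))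
  have bound : ∀ z₁ z₂ : ℕ → ℝ, (∀ n : ℕ,
              z₁ n = x₁ n +
                  ∑ k ∈ Finset.Icc 1 (min N n), (u k * z₁ (n - k) + v k * z₂ (n - k)) ∧
              z₂ n = x₂ n +
                  ∑ k ∈ Finset.Icc 1 (min N n), (u k * z₂ (n - k) + v k * z₁ (n - k))) →
          ∀ n : ℕ,
            |z₁ n - ((1 / 2) * ∑' k : ℕ, (x₁ k + x₂ k)) / J| ≤ M * C n ∧
            |z₂ n - ((1 / 2) * ∑' k : ℕ, (x₁ k + x₂ k)) / J| ≤ M * C n := by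
    intro z₁ z₂ hz n
    obtain ⟨b1, b2⟩ := hC M (fun n => x₁ n + x₂ n) (fun n => z₁ n + z₂ n)
      (fun n => x₁ n - x₂ n) (fun n => z₁ n - z₂ n) q₁ q₂ (by
        intro n
        rw [(hz n).1, (hz n).2, add_add_add_comm, ← Finset.sum_add_distrib]
        congr 1
        exact Finset.sum_congr rfl fun k _ => by ring) (by
        intro n
        rw [(hz n).1, (hz n).2, add_sub_add_comm, ← Finset.sum_sub_distrib]
        congr 1
        exact Finset.sum_congr rfl fun k _ => by ring) n
    have e : ((1 / 2) * ∑' k : ℕ, (x₁ k + x₂ k)) / J = (1 / 2) * ((∑' k : ℕ, (x₁ k + x₂ k)) / J) := by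
      ring
    rw [e]
    rw [abs_le] at b1 b2
    constructor <;> rw [abs_le] <;> constructor <;> linarith [b1.1, b1.2, b2.1, b2.2]
  refine ⟨?_, fun z₁ z₂ _ _ hz => bound z₁ z₂ hz⟩
  obtain ⟨s, hs⟩ := aux_solve N (fun k => u k + v k) (fun n => x₁ n + x₂ n)
  obtain ⟨d, hd⟩ := aux_solve N (fun k => u k - v k) (fun n => x₁ n - x₂ n)
  have hrec : ∀ n : ℕ,
      (s n + d n) / 2 = x₁ n + ∑ k ∈ Finset.Icc 1 (min N n),
        (u k * ((s (n - k) + d (n - k)) / 2) + v k * ((s (n - k) - d (n - k)) / 2)) ∧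
      (s n - d n) / 2 = x₂ n + ∑ k ∈ Finset.Icc 1 (min N n),
        (u k * ((s (n - k) - d (n - k)) / 2) + v k * ((s (n - k) + d (n - k)) / 2)) := by
    intro n
    have e1 : ∑ k ∈ Finset.Icc 1 (min N n),
        (u k * ((s (n - k) + d (n - k)) / 2) + v k * ((s (n - k) - d (n - k)) / 2))
        = (∑ k ∈ Finset.Icc 1 (min N n), (u k + v k) * s (n - k)
          + ∑ k ∈ Finset.Icc 1 (min N n), (u k - v k) * d (n - k)) / 2 := by
      rw [← Finset.sum_add_distrib, Finset.sum_div]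
      exact Finset.sum_congr rfl fun k _ => by ring
    have e2 : ∑ k ∈ Finset.Icc 1 (min N n),
        (u k * ((s (n - k) - d (n - k)) / 2) + v k * ((s (n - k) + d (n - k)) / 2))
        = (∑ k ∈ Finset.Icc 1 (min N n), (u k + v k) * s (n - k)
          - ∑ k ∈ Finset.Icc 1 (min N n), (u k - v k) * d (n - k)) / 2 := by
      rw [← Finset.sum_sub_distrib, Finset.sum_div]
      exact Finset.sum_congr rfl fun k _ => by ring
    have := hs n
    have := hd n
    rw [e1, e2]
    constructor <;> linarith
  have hb := bound (fun n => (s n + d n) / 2) (fun n => (s n - d n) / 2) hrec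
  obtain ⟨D, hD⟩ := hCt.bddAbove_range
  have hD' : ∀ n, C n ≤ D := fun n => hD ⟨n, rfl⟩
  have hM0 : 0 ≤ M := by simpa using (abs_nonneg _).trans (q₁ 0)
  have summ : ∀ (z : ℕ → ℝ) (c : ℝ), (∀ n, |z n - c| ≤ M * C n) →
      Summable (fun n => r ^ n * |z n|) := by
    intro z c h
    refine Summable.of_nonneg_of_le (fun n => by positivity) (fun n => ?_)
      ((summable_geometric_of_lt_one hr0.le hr1).mul_right (M * D + |c|))
    have h1 : |z n| ≤ M * D + |c| := by
      have h2 := abs_add_le (z n - c) c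
      rw [sub_add_cancel] at h2
      have h3 := mul_le_mul_of_nonneg_left (hD' n) hM0
      linarith [h n]
    exact mul_le_mul_of_nonneg_left h1 (by positivity)
  refine ⟨(fun n => (s n + d n) / 2, fun n => (s n - d n) / 2),
    ⟨⟨summ _ _ fun n => (hb n).1, summ _ _ fun n => (hb n).2⟩, hrec⟩, ?_⟩
  rintro ⟨z₁, z₂⟩ ⟨-, hz⟩
  simp only at hz
  have huniq : ∀ n, z₁ n = (s n + d n) / 2 ∧ z₂ n = (s n - d n) / 2 := by
    intro n
    induction n using Nat.strong_induction_on with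
    | _ n ih =>
      rw [(hz n).1, (hz n).2, (hrec n).1, (hrec n).2]
      have hlt : ∀ k ∈ Finset.Icc 1 (min N n), n - k < n := fun k hk => by
        rw [Finset.mem_Icc, le_min_iff] at hk
        omega
      constructor <;> congr 1 <;> refine Finset.sum_congr rfl fun k hk => ?_ <;>
        rw [(ih _ (hlt k hk)).1, (ih _ (hlt k hk)).2]
  ext n
  · exact (huniq n).1
  · exact (huniq n).2
end

section
/- Let τ > 0 be fixed and let u_1, …, u_N be nonnegative reals with ∑_{k=1}^N u_k = 1 such that the greatest common divisor of the set of indices k with u_k > 0 equals 1. Let X : ℝ → ℝ be continuous with X(t) = 0 for all t ≤ 0 and |X(t)| ≤ Π e^{−τ t} for all t ≥ 0, where Π > 0. Then there exists a unique continuous function Z : ℝ → ℝ with Z(t) = 0 for all t < 0 and Z(t) = X(t) + ∑_{k=1}^N u_k Z(t−k) for all t ≥ 0. Moreover, there is a continuous function C : ℝ⁺ → ℝ⁺ tending to 0 at +∞, depending only on τ, N and the u_k (not on X or Π), such that |Z(t) − s(t)| ≤ Π · C(t) for all t ≥ 0, where s is the continuous 1-periodic function s(t) = (1/J) ∑_{k=−∞}^{+∞}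 X(t−k) and J = ∑_{k=1}^N k u_k. -/
open Filter

noncomputable def renewalSeq (N : ℕ) (u : ℕ → ℝ) : ℕ → ℝ
  | 0 => 1
  | (n + 1) => ∑ k : Fin (n + 1), (if (k : ℕ) + 1 ≤ N then u (k + 1) else 0) * renewalSeq N u (n - k)
termination_by n => n
decreasing_by omega

noncomputable def renewalInt (N : ℕ) (u : ℕ → ℝ) (n : ℤ) : ℝ :=
  if n < 0 then 0 else renewalSeq N u n.toNat

lemma renewalInt_neg (N : ℕ) (u : ℕ → ℝ) (n : ℤ) (hn : n < 0) : renewalInt N u n = 0 := by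
  simp [renewalInt, hn]

lemma renewalInt_zero (N : ℕ) (u : ℕ → ℝ) : renewalInt N u 0 = 1 := by
  simp [renewalInt, renewalSeq]

lemma renewalInt_pos (N : ℕ) (u : ℕ → ℝ) (n : ℤ) (hn : 0 < n) :
    renewalInt N u n = ∑ k ∈ Finset.Icc 1 N, u k * renewalInt N u (n - k) := by
  obtain ⟨m, rfl⟩ : ∃ m : ℕ, n = (m : ℤ) + 1 := ⟨(n - 1).toNat, by omega⟩
  have h1 : renewalInt N u ((m : ℤ) + 1) = ∑ k ∈ Finset.range (m + 1),
      (if k + 1 ≤ N then u (k + 1) else 0) * renewalInt N u ((m : ℤ) + 1 - (k + 1 : ℕ)) := by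
    rw [renewalInt, if_neg (by omega)]
    have : ((m : ℤ) + 1).toNat = m + 1 := by omega
    rw [this, renewalSeq, Finset.sum_range]
    refine Finset.sum_congr rfl fun k _ => ?_
    have hk := k.2
    congr 1
    rw [renewalInt, if_neg (by push_cast; omega)]
    congr 1
    push_cast
    omega
  rw [h1]
  have h2 : ∑ k ∈ Finset.Icc 1 N, u k * renewalInt N u ((m : ℤ) + 1 - k)
      = ∑ k ∈ Finset.range N, u (k + 1) * renewalInt N u ((m : ℤ) + 1 - (k + 1 : ℕ)) := by
    rw [Finset.range_eq_Ico, Finset.sum_Ico_add' (fun k => u k * renewalInt N u ((m : ℤ) + 1 - k)) 0 N 1]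
    rfl
  rw [h2]
  trans ∑ k ∈ Finset.range (m + 1 + N),
      (if k + 1 ≤ N then u (k + 1) else 0) * renewalInt N u ((m : ℤ) + 1 - (k + 1 : ℕ))
  · apply Finset.sum_subset
    · intro x; simp; omega
    · intro x hx hx'
      simp at hx hx'
      rw [renewalInt_neg _ _ _ (by push_cast; omega), mul_zero]
  · symm
    trans ∑ k ∈ Finset.range N,
      (if k + 1 ≤ N then u (k + 1) else 0) * renewalInt N u ((m : ℤ) + 1 - (k + 1 : ℕ))
    · refine Finset.sum_congr rfl fun k hk => ?_
      simp at hk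
      rw [if_pos (by omega)]
    · apply Finset.sum_subset
      · intro x; simp; omega
      · intro x hx hx'
        simp at hx hx'
        rw [if_neg (by omega), zero_mul]

section
variable {N : ℕ} {u : ℕ → ℝ} {R : ℤ → ℝ}

lemma R_bounds
    (hu : ∀ k ∈ Finset.Icc 1 N, 0 ≤ u k)
    (hs : ∑ k ∈ Finset.Icc 1 N, u k = 1)
    (hneg : ∀ n < 0, R n = 0) (h0 : R 0 = 1)
    (hrec : ∀ n, 0 < n → R n = ∑ k ∈ Finset.Icc 1 N, u k * R (n - k)) (n : ℤ) :
    0 ≤ R n ∧ R n ≤ 1 := by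
  have key : ∀ c : ℕ, ∀ m : ℤ, m < c → 0 ≤ R m ∧ R m ≤ 1 := by
    intro c
    induction c with
    | zero => intro m hm; rw [hneg m (by simpa using hm)]; norm_num
    | succ c ih =>
      intro m hm
      rcases lt_trichotomy m 0 with h | h | h
      · rw [hneg m h]; norm_num
      · rw [h, h0]; norm_num
      · rw [hrec m h]
        have hi : ∀ k ∈ Finset.Icc 1 N, 0 ≤ R (m - k) ∧ R (m - k) ≤ 1 := by
          intro k hk
          rw [Finset.mem_Icc] at hk
          apply ih
          push_cast at hm
          omega
        constructor
        · exact Finset.sum_nonneg fun k hk => mul_nonneg (hu k hk) (hi k hk).1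
        · rw [← hs]
          exact Finset.sum_le_sum fun k hk => mul_le_of_le_one_right (hu k hk) (hi k hk).2
  exact key (n.toNat + 1) n (by push_cast; omega)

lemma R_invariant
    (hs : ∑ k ∈ Finset.Icc 1 N, u k = 1)
    (hneg : ∀ n < 0, R n = 0) (h0 : R 0 = 1)
    (hrec : ∀ n, 0 < n → R n = ∑ k ∈ Finset.Icc 1 N, u k * R (n - k)) (n : ℕ) :
    ∑ k ∈ Finset.Icc 1 N, u k * ∑ j ∈ Finset.range k, R ((n : ℤ) - j) = 1 := by
  induction n with
  | zero =>
    rw [← hs]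
    refine Finset.sum_congr rfl fun k hk => ?_
    rw [Finset.mem_Icc] at hk
    rw [Finset.sum_eq_single_of_mem 0 (by simp; omega)]
    · simp [h0]
    · intro j _ hj
      exact hneg _ (by push_cast; omega)
  | succ n ih =>
    have : ∀ k : ℕ, ∑ j ∈ Finset.range k, R (((n + 1 : ℕ) : ℤ) - j)
        = ∑ j ∈ Finset.range k, R ((n : ℤ) - j) + (R ((n : ℤ) + 1) - R ((n : ℤ) + 1 - k)) := by
      intro k
      induction k with
      | zero => simp
      | succ k ihk =>
        rw [Finset.sum_range_succ, Finset.sum_range_succ, ihk]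
        push_cast
        have : (n : ℤ) + 1 - (k + 1) = n - k := by ring
        rw [this]
        ring
    simp_rw [this, mul_add, Finset.sum_add_distrib, ih, mul_sub, Finset.sum_sub_distrib]
    rw [← hrec _ (by omega), ← Finset.sum_mul, hs]
    ring

lemma exists_nonpos {e : ℤ → ℝ}
    (hu : ∀ k ∈ Finset.Icc 1 N, 0 ≤ u k)
    (hs : ∑ k ∈ Finset.Icc 1 N, u k = 1) (n : ℤ)
    (he : ∑ k ∈ Finset.Icc 1 N, u k * ∑ j ∈ Finset.range k, e (n - j) = 0) :
    ∃ i, n - N < i ∧ i ≤ n ∧ e i ≤ 0 := by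
  by_contra! hcon
  have hpos : ∀ k ∈ Finset.Icc 1 N, 0 < ∑ j ∈ Finset.range k, e (n - j) := by
    intro k hk
    rw [Finset.mem_Icc] at hk
    apply Finset.sum_pos
    · intro j hj
      rw [Finset.mem_range] at hj
      exact hcon _ (by omega) (by omega)
    · simp; omega
  have hz := (Finset.sum_eq_zero_iff_of_nonneg
    (fun k hk => mul_nonneg (hu k hk) (hpos k hk).le)).1 he
  have : ∑ k ∈ Finset.Icc 1 N, u k = 0 := Finset.sum_eq_zero fun k hk =>
    (mul_eq_zero.1 (hz k hk)).resolve_right (hpos k hk).ne'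
  linarith

lemma R_lower
    (hu : ∀ k ∈ Finset.Icc 1 N, 0 ≤ u k)
    (hs : ∑ k ∈ Finset.Icc 1 N, u k = 1)
    (hg : ((Finset.Icc 1 N).filter (fun k => 0 < u k)).gcd id = 1)
    (hneg : ∀ n < 0, R n = 0) (h0 : R 0 = 1)
    (hrec : ∀ n, 0 < n → R n = ∑ k ∈ Finset.Icc 1 N, u k * R (n - k)) :
    ∃ n0 : ℕ, ∃ δ : ℝ, 0 < δ ∧ ∀ n : ℤ, n0 ≤ n → δ ≤ R n := by
  have hb := R_bounds hu hs hneg h0 hrec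
  set s : Set ℕ := {k | k ∈ Finset.Icc 1 N ∧ 0 < u k} with hsdef
  have hgs : Nat.setGcd s = 1 := by
    have : Nat.setGcd s ∣ ((Finset.Icc 1 N).filter (fun k => 0 < u k)).gcd id := by
      apply Finset.dvd_gcd
      intro k hk
      apply Nat.setGcd_dvd_of_mem
      simpa [hsdef] using hk
    rw [hg] at this
    exact Nat.dvd_one.1 this
  obtain ⟨n0, hn0⟩ := Nat.exists_mem_closure_of_ge s
  have hcl : ∀ a ∈ AddSubmonoid.closure s, ∀ b : ℕ, 0 < R b → 0 < R ((b + a : ℕ) : ℤ) := by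
    intro a ha
    induction ha using AddSubmonoid.closure_induction with
    | mem k hk =>
      intro b hbp
      obtain ⟨hk1, hk2⟩ := hk
      have hk3 := Finset.mem_Icc.1 hk1
      rw [hrec _ (by push_cast; omega)]
      apply Finset.sum_pos' (fun j hj => mul_nonneg (hu j hj) (hb _).1)
      refine ⟨k, hk1, mul_pos hk2 ?_⟩
      simpa using hbp
    | zero => intro b hb; simpa using hb
    | add x y _ _ hx hy =>
      intro b hb
      rw [← add_assoc]
      exact hy _ (hx _ hb)
  have hpos : ∀ m : ℕ, n0 ≤ m → 0 < R m := by
    intro m hm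
    have := hcl m (hn0 m hm (by rw [hgs]; exact one_dvd _)) 0 (by simp [h0])
    simpa using this
  obtain ⟨i0, hi0, hmin⟩ := Finset.exists_min_image (Finset.Icc n0 (n0 + N)) (fun m : ℕ => R m)
    ⟨n0, by simp⟩
  refine ⟨n0, R i0, hpos _ (Finset.mem_Icc.1 hi0).1, ?_⟩
  have key : ∀ c : ℕ, ∀ n : ℤ, n0 ≤ n → n < c → R i0 ≤ R n := by
    intro c
    induction c with
    | zero => intro n h1 h2; push_cast at h2; omega
    | succ c ih =>
      intro n h1 h2
      push_cast at h2
      by_cases h : n ≤ n0 + N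
      · have := hmin n.toNat (by rw [Finset.mem_Icc]; omega)
        have h3 : ((n.toNat : ℕ) : ℤ) = n := by omega
        simpa [h3] using this
      · rw [hrec n (by omega)]
        calc R i0 = ∑ k ∈ Finset.Icc 1 N, u k * R i0 := by rw [← Finset.sum_mul, hs, one_mul]
          _ ≤ _ := by
            refine Finset.sum_le_sum fun k hk => mul_le_mul_of_nonneg_left ?_ (hu k hk)
            rw [Finset.mem_Icc] at hk
            exact ih _ (by omega) (by omega)
  intro n hn
  exact key (n.toNat + 1) n hn (by push_cast; omega)

lemma one_sided {e : ℤ → ℝ}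
    (hu : ∀ k ∈ Finset.Icc 1 N, 0 ≤ u k)
    (hs : ∑ k ∈ Finset.Icc 1 N, u k = 1)
    (hneg : ∀ n < 0, R n = 0) (h0 : R 0 = 1)
    (hrec : ∀ n, 0 < n → R n = ∑ k ∈ Finset.Icc 1 N, u k * R (n - k))
    (hrece : ∀ n, 0 < n → e n = ∑ k ∈ Finset.Icc 1 N, u k * e (n - k))
    (M : ℝ) (n i : ℤ) (hn : 0 ≤ n) (hi : n + N < i) (hM : ∀ j, n ≤ j → e j ≤ M)
    (hei : e i ≤ 0) (m : ℤ) (hm : 0 ≤ m) : e (i + m) ≤ M - R m * M := by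
  have key : ∀ c : ℕ, ∀ m : ℤ, -(N : ℤ) ≤ m → m < c → R m * M ≤ M - e (i + m) := by
    intro c
    induction c with
    | zero =>
      intro m h1 h2
      rw [hneg m (by simpa using h2)]
      have := hM (i + m) (by omega)
      linarith
    | succ c ih =>
      intro m h1 h2
      push_cast at h2
      rcases lt_trichotomy m 0 with h | h | h
      · rw [hneg m h]
        have := hM (i + m) (by omega)
        linarith
      · subst h
        rw [h0, add_zero]; linarith
      · rw [hrec m h, hrece (i + m) (by omega), Finset.sum_mul]
        have : M = ∑ k ∈ Finset.Icc 1 N, u k * M := by rw [← Finset.sum_mul, hs, one_mul]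
        calc _ ≤ ∑ k ∈ Finset.Icc 1 N, u k * (M - e (i + (m - k))) := by
              refine Finset.sum_le_sum fun k hk => ?_
              rw [mul_assoc]
              refine mul_le_mul_of_nonneg_left ?_ (hu k hk)
              rw [Finset.mem_Icc] at hk
              exact ih _ (by omega) (by omega)
          _ = ∑ k ∈ Finset.Icc 1 N, u k * M - ∑ k ∈ Finset.Icc 1 N, u k * e (i + m - k) := by
              rw [← Finset.sum_sub_distrib]
              refine Finset.sum_congr rfl fun k _ => ?_
              rw [add_sub_assoc]; ring
          _ = _ := by rw [← this]
  have := key (m.toNat + 1) m (by omega) (by push_cast; omega)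
  linarith

lemma J_ge_one (hu : ∀ k ∈ Finset.Icc 1 N, 0 ≤ u k)
    (hs : ∑ k ∈ Finset.Icc 1 N, u k = 1) : 1 ≤ ∑ k ∈ Finset.Icc 1 N, (k : ℝ) * u k := by
  rw [← hs]
  refine Finset.sum_le_sum fun k hk => le_mul_of_one_le_left (hu k hk) ?_
  exact_mod_cast (Finset.mem_Icc.1 hk).1

lemma R_decay_pow
    (hu : ∀ k ∈ Finset.Icc 1 N, 0 ≤ u k)
    (hs : ∑ k ∈ Finset.Icc 1 N, u k = 1)
    (hg : ((Finset.Icc 1 N).filter (fun k => 0 < u k)).gcd id = 1)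
    (hneg : ∀ n < 0, R n = 0) (h0 : R 0 = 1)
    (hrec : ∀ n, 0 < n → R n = ∑ k ∈ Finset.Icc 1 N, u k * R (n - k)) :
    ∃ L : ℕ, 0 < L ∧ ∃ ρ : ℝ, 0 < ρ ∧ ρ < 1 ∧ ∀ q : ℕ, ∀ n : ℤ, (q * L : ℕ) ≤ n →
      |R n - 1 / ∑ k ∈ Finset.Icc 1 N, (k : ℝ) * u k| ≤ ρ ^ q := by
  have hJ := J_ge_one hu hs
  have hb := R_bounds hu hs hneg h0 hrec
  have hinv := R_invariant hs hneg h0 hrec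
  obtain ⟨n0, δ', hδ', hlow'⟩ := R_lower hu hs hg hneg h0 hrec
  set δ := min δ' (1 / 2) with hδdef
  have hδ : 0 < δ := by positivity
  have hδ2 : δ ≤ 1 / 2 := min_le_right _ _
  have hlow : ∀ n : ℤ, n0 ≤ n → δ ≤ R n := fun n hn => (min_le_left _ _).trans (hlow' n hn)
  set J := ∑ k ∈ Finset.Icc 1 N, (k : ℝ) * u k with hJdef
  set e : ℤ → ℝ := fun n => R n - 1 / J with he
  have hJ1 : 1 / J ≤ 1 := by rw [div_le_one (by linarith)]; exact hJ
  have hJ0 : 0 ≤ 1 / J := by positivity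
  have hrece : ∀ n, 0 < n → e n = ∑ k ∈ Finset.Icc 1 N, u k * e (n - k) := by
    intro n hn
    simp only [he, mul_sub, Finset.sum_sub_distrib]
    rw [← hrec n hn, ← Finset.sum_mul, hs, one_mul]
  have hrece' : ∀ n, 0 < n → -e n = ∑ k ∈ Finset.Icc 1 N, u k * -e (n - k) := by
    intro n hn
    rw [hrece n hn]; simp
  have hinve : ∀ n : ℕ, ∑ k ∈ Finset.Icc 1 N, u k * ∑ j ∈ Finset.range k, e ((n : ℤ) - j) = 0 := by
    intro n
    simp only [he, mul_sub, Finset.sum_sub_distrib, hinv n]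
    simp only [Finset.sum_const, Finset.card_range, nsmul_eq_mul]
    have : ∑ k ∈ Finset.Icc 1 N, u k * ((k : ℝ) * (1 / J)) = J * (1 / J) := by
      rw [hJdef, Finset.sum_mul]
      exact Finset.sum_congr rfl fun k _ => by ring
    rw [this, mul_one_div_cancel (by linarith), sub_self]
  refine ⟨2 * N + n0 + 1, by omega, 1 - δ, by linarith, by linarith, ?_⟩
  intro q
  induction q with
  | zero =>
    intro n _
    have := hb n
    rw [pow_zero, abs_le]
    constructor <;> linarith
  | succ q ih =>
    set n1 : ℕ := q * (2 * N + n0 + 1) with hn1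
    intro n hn
    have hn' : (n1 : ℤ) + (2 * N + n0 + 1) ≤ n := by
      rw [hn1]; push_cast at hn ⊢; linarith
    have hM0 : 0 ≤ (1 - δ) ^ q := pow_nonneg (by linarith) _
    set M := (1 - δ) ^ q with hM
    rw [pow_succ]
    have hfin : ∀ f : ℤ → ℝ, (∀ n, 0 < n → f n = ∑ k ∈ Finset.Icc 1 N, u k * f (n - k)) →
        (∑ k ∈ Finset.Icc 1 N, u k * ∑ j ∈ Finset.range k, f (((n1 + 2 * N + 1 : ℕ) : ℤ) - j) = 0) →
        (∀ j, (n1 : ℤ) ≤ j → f j ≤ M) → f n ≤ M * (1 - δ) := by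
      intro f hf1 hf2 hf3
      obtain ⟨i, hi1, hi2, hi3⟩ := exists_nonpos hu hs _ hf2
      push_cast at hi1 hi2
      have := one_sided hu hs hneg h0 hrec hf1 M n1 i (by omega) (by omega) hf3 hi3 (n - i)
        (by omega)
      rw [add_sub_cancel] at this
      have h5 := mul_le_mul_of_nonneg_right (hlow (n - i) (by omega)) hM0
      linarith
    rw [abs_le]
    constructor
    · have := hfin (fun n => -e n) hrece' (by
        have := hinve (n1 + 2 * N + 1)
        simp only [Finset.sum_neg_distrib, mul_neg, this, neg_zero])
        (fun j hj => by have := (abs_le.1 (ih j hj)).1; simp only [he]; linarith)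
      simp only [he] at this
      linarith
    · exact hfin e hrece (hinve _) (fun j hj => (abs_le.1 (ih j hj)).2)

lemma R_decay_exp
    (hu : ∀ k ∈ Finset.Icc 1 N, 0 ≤ u k)
    (hs : ∑ k ∈ Finset.Icc 1 N, u k = 1)
    (hg : ((Finset.Icc 1 N).filter (fun k => 0 < u k)).gcd id = 1)
    (hneg : ∀ n < 0, R n = 0) (h0 : R 0 = 1)
    (hrec : ∀ n, 0 < n → R n = ∑ k ∈ Finset.Icc 1 N, u k * R (n - k)) (τ : ℝ) (hτ : 0 < τ) :
    ∃ A : ℝ, 0 ≤ A ∧ ∃ σ : ℝ, 0 < σ ∧ σ ≤ τ ∧ ∀ n : ℕ,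
      |R n - 1 / ∑ k ∈ Finset.Icc 1 N, (k : ℝ) * u k| ≤ A * Real.exp (-σ * n) := by
  obtain ⟨L, hL, ρ, hρ, hρ1, hd⟩ := R_decay_pow hu hs hg hneg h0 hrec
  have hlog : Real.log ρ < 0 := Real.log_neg hρ hρ1
  have hL' : (0 : ℝ) < L := by exact_mod_cast hL
  refine ⟨1 / ρ, by positivity, min τ (-Real.log ρ / L), lt_min hτ (div_pos (by linarith) hL'),
    min_le_left _ _, fun n => ?_⟩
  have hq := hd (n / L) n (by exact_mod_cast Nat.div_mul_le_self n L)
  refine hq.trans ?_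
  set σ := min τ (-Real.log ρ / L) with hσ
  have hσ2 : σ * L ≤ -Real.log ρ := by
    rw [← le_div_iff₀ hL']; exact min_le_right _ _
  have hσ0 : 0 < σ := lt_min hτ (div_pos (by linarith) hL')
  have hn : (n : ℝ) ≤ ((n / L : ℕ) + 1 : ℝ) * L := by
    have := Nat.lt_div_mul_add hL (a := n)
    have h2 : n ≤ (n / L + 1) * L := by rw [add_mul]; omega
    exact_mod_cast h2
  set q := n / L
  have h3 : ρ ^ (q + 1) ≤ Real.exp (-σ * n) := by
    rw [← Real.exp_log hρ, ← Real.exp_nat_mul, Real.exp_le_exp]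
    push_cast
    have h4 : σ * n ≤ σ * (((q : ℝ) + 1) * L) := mul_le_mul_of_nonneg_left hn hσ0.le
    have h5 : ((q : ℝ) + 1) * (σ * L) ≤ ((q : ℝ) + 1) * (-Real.log ρ) :=
      mul_le_mul_of_nonneg_left hσ2 (by positivity)
    linarith
  calc ρ ^ q = 1 / ρ * ρ ^ (q + 1) := by rw [pow_succ]; field_simp
    _ ≤ _ := mul_le_mul_of_nonneg_left h3 (by positivity)

end

/-- The explicit solution of the renewal equation. -/
noncomputable def renewalSol (R : ℤ → ℝ) (X : ℝ → ℝ) (t : ℝ) : ℝ :=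
  ∑ n ∈ Finset.range ⌈t⌉₊, R n * X (t - n)

lemma renewalSol_eq (R : ℤ → ℝ) (X : ℝ → ℝ) (hX : ∀ t : ℝ, t ≤ 0 → X t = 0) (t : ℝ) (K : ℕ)
    (hK : t ≤ K) : renewalSol R X t = ∑ n ∈ Finset.range K, R n * X (t - n) := by
  apply Finset.sum_subset
  · intro x hx
    simp only [Finset.mem_range] at *
    exact hx.trans_le (Nat.ceil_le.2 hK)
  · intro x _ hx
    simp only [Finset.mem_range, not_lt] at hx
    rw [hX _ (by linarith [Nat.ceil_le.1 hx]), mul_zero]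

lemma renewalSol_continuous (R : ℤ → ℝ) (X : ℝ → ℝ) (hX : ∀ t : ℝ, t ≤ 0 → X t = 0)
    (hc : Continuous X) : Continuous (renewalSol R X) := by
  rw [continuous_iff_continuousAt]
  intro t
  obtain ⟨K, hK⟩ := exists_nat_gt t
  have h1 : Continuous fun t : ℝ => ∑ n ∈ Finset.range K, R n * X (t - n) := by fun_prop
  refine h1.continuousAt.congr ?_
  filter_upwards [Iio_mem_nhds hK] with x hx
  exact (renewalSol_eq R X hX x K (le_of_lt hx)).symm

lemma renewalSol_rec {N : ℕ} {u : ℕ → ℝ} {R : ℤ → ℝ}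
    (hneg : ∀ n < 0, R n = 0) (h0 : R 0 = 1)
    (hrec : ∀ n, 0 < n → R n = ∑ k ∈ Finset.Icc 1 N, u k * R (n - k))
    (X : ℝ → ℝ) (hX : ∀ t : ℝ, t ≤ 0 → X t = 0) (t : ℝ) :
    renewalSol R X t = X t + ∑ k ∈ Finset.Icc 1 N, u k * renewalSol R X (t - k) := by
  obtain ⟨K, hK⟩ := exists_nat_gt t
  have hshift : ∀ k : ℕ, renewalSol R X (t - k)
      = ∑ n ∈ Finset.range (K + 1), R ((n : ℤ) - k) * X (t - n) := by
    intro k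
    trans ∑ n ∈ Finset.range (k + (K + 1)), R ((n : ℤ) - k) * X (t - n)
    · rw [Finset.sum_range_add, Finset.sum_eq_zero (s := Finset.range k), zero_add,
        renewalSol_eq R X hX (t - k) (K + 1)]
      · refine Finset.sum_congr rfl fun n _ => ?_
        congr 2 <;> push_cast <;> ring
      · have : (0 : ℝ) ≤ k := Nat.cast_nonneg k
        push_cast; linarith
      · intro n hn
        rw [Finset.mem_range] at hn
        rw [hneg _ (by omega), zero_mul]
    · symm
      apply Finset.sum_subset
      · intro x; simp; omega
      · intro x _ hx
        simp only [Finset.mem_range, not_lt] at hx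
        have : ((K + 1 : ℕ) : ℝ) ≤ x := by exact_mod_cast hx
        push_cast at this
        rw [hX _ (by linarith), mul_zero]
  simp_rw [hshift, Finset.mul_sum]
  rw [Finset.sum_comm, renewalSol_eq R X hX t (K + 1) (by push_cast; linarith),
    Finset.sum_range_succ', Finset.sum_range_succ' (fun n : ℕ => ∑ k ∈ Finset.Icc 1 N, _)]
  have hz : ∑ k ∈ Finset.Icc 1 N, u k * (R (((0 : ℕ) : ℤ) - k) * X (t - (0 : ℕ))) = 0 := by
    refine Finset.sum_eq_zero fun k hk => ?_
    rw [Finset.mem_Icc] at hk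
    rw [hneg _ (by push_cast; omega)]; ring
  rw [hz]
  have : ∀ n : ℕ, R ((n + 1 : ℕ) : ℤ) * X (t - (n + 1 : ℕ))
      = ∑ k ∈ Finset.Icc 1 N, u k * (R (((n + 1 : ℕ) : ℤ) - k) * X (t - (n + 1 : ℕ))) := by
    intro n
    rw [hrec _ (by omega), Finset.sum_mul]
    exact Finset.sum_congr rfl fun k _ => by ring
  simp_rw [← this]
  simp [h0]
  ring

lemma renewal_unique {N : ℕ} {u : ℕ → ℝ} {X Z W : ℝ → ℝ}
    (hZ : ∀ t : ℝ, t < 0 → Z t = 0) (hW : ∀ t : ℝ, t < 0 → W t = 0)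
    (hZr : ∀ t : ℝ, 0 ≤ t → Z t = X t + ∑ k ∈ Finset.Icc 1 N, u k * Z (t - k))
    (hWr : ∀ t : ℝ, 0 ≤ t → W t = X t + ∑ k ∈ Finset.Icc 1 N, u k * W (t - k)) : Z = W := by
  have key : ∀ c : ℕ, ∀ t : ℝ, t < c → Z t = W t := by
    intro c
    induction c with
    | zero => intro t ht; rw [hZ t (by simpa using ht), hW t (by simpa using ht)]
    | succ c ih =>
      intro t ht
      rcases lt_or_ge t 0 with h | h
      · rw [hZ t h, hW t h]
      · rw [hZr t h, hWr t h]
        congr 1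
        refine Finset.sum_congr rfl fun k hk => ?_
        have h1 : (1 : ℝ) ≤ k := by exact_mod_cast (Finset.mem_Icc.1 hk).1
        rw [ih]
        push_cast at ht
        linarith
  funext t
  obtain ⟨c, hc⟩ := exists_nat_gt t
  exact key c t hc

lemma tsum_split {τ : ℝ} (hτ : 0 < τ) {X : ℝ → ℝ} {P : ℝ} (hX : ∀ t : ℝ, t ≤ 0 → X t = 0)
    (hb : ∀ t : ℝ, 0 ≤ t → |X t| ≤ P * Real.exp (-τ * t)) (hP : 0 < P) (t : ℝ) (ht : 0 ≤ t)
    (K : ℕ) (hK : t ≤ K) :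
    ∃ E : ℝ, |E| ≤ P * ((1 - Real.exp (-τ))⁻¹ * Real.exp (-τ * t)) ∧
      ∑' k : ℤ, X (t - k) = ∑ n ∈ Finset.range K, X (t - n) + E := by
  have hr1 : Real.exp (-τ) < 1 := by rw [Real.exp_lt_one_iff]; linarith
  have hgeo := (hasSum_geometric_of_lt_one (Real.exp_pos (-τ)).le hr1).mul_left
    (P * Real.exp (-τ * t))
  have hbd : ∀ n : ℕ, ‖X (t - ((-((n : ℤ) + 1) : ℤ) : ℝ))‖
      ≤ P * Real.exp (-τ * t) * Real.exp (-τ) ^ n := by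
    intro n
    rw [Real.norm_eq_abs]
    have hn : (0 : ℝ) ≤ n := Nat.cast_nonneg n
    push_cast
    refine (hb _ (by linarith)).trans ?_
    rw [← Real.exp_nat_mul, mul_assoc, ← Real.exp_add]
    refine mul_le_mul_of_nonneg_left (Real.exp_le_exp.2 ?_) hP.le
    nlinarith
  have hz : ∀ n : ℕ, n ∉ Finset.range K → X (t - ((n : ℤ) : ℝ)) = 0 := by
    intro n hn
    simp only [Finset.mem_range, not_lt] at hn
    have : (K : ℝ) ≤ n := by exact_mod_cast hn
    exact hX _ (by push_cast; linarith)
  refine ⟨∑' n : ℕ, X (t - ((-((n : ℤ) + 1) : ℤ) : ℝ)), ?_, ?_⟩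
  · have := tsum_of_norm_bounded hgeo hbd
    rw [Real.norm_eq_abs] at this
    refine this.trans (le_of_eq ?_)
    ring
  · rw [tsum_of_nat_of_neg_add_one (f := fun k : ℤ => X (t - k))
      (summable_of_ne_finset_zero hz) (Summable.of_norm_bounded hgeo.summable hbd),
      tsum_eq_sum hz]
    simp

/-- renewal theorem with remainder estimate.
`s(t) = (1/J) ∑_{k ∈ ℤ} X(t - k)` is written with a `tsum` over `ℤ`. -/
theorem stmt_2
    (τ : ℝ) (hτ : 0 < τ)
    (N : ℕ) (u : ℕ → ℝ)
    (hu_nonneg : ∀ k ∈ Finset.Icc 1 N, 0 ≤ u k)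
    (hu_sum : ∑ k ∈ Finset.Icc 1 N, u k = 1)
    (hu_gcd : ((Finset.Icc 1 N).filter (fun k => 0 < u k)).gcd id = 1) :
    ∃ C : ℝ → ℝ, Continuous C ∧ (∀ t, 0 ≤ C t) ∧ Tendsto C atTop (nhds 0) ∧
      ∀ (X : ℝ → ℝ) (Pi : ℝ), 0 < Pi → Continuous X →
        (∀ t : ℝ, t ≤ 0 → X t = 0) →
        (∀ t : ℝ, 0 ≤ t → |X t| ≤ Pi * Real.exp (-τ * t)) →
        (∃! Z : ℝ → ℝ, Continuous Z ∧ (∀ t : ℝ, t < 0 → Z t = 0) ∧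
            ∀ t : ℝ, 0 ≤ t →
              Z t = X t + ∑ k ∈ Finset.Icc 1 N, u k * Z (t - k)) ∧
        (∀ Z : ℝ → ℝ,
          Continuous Z → (∀ t : ℝ, t < 0 → Z t = 0) →
          (∀ t : ℝ, 0 ≤ t → Z t = X t + ∑ k ∈ Finset.Icc 1 N, u k * Z (t - k)) →
          ∀ t : ℝ, 0 ≤ t →
            |Z t - (1 / ∑ k ∈ Finset.Icc 1 N, (k : ℝ) * u k) * ∑' k : ℤ, X (t - k)| ≤
              Pi * C t) := by
  have hneg := renewalInt_neg N u
  have h0 := renewalInt_zero N u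
  have hrec := renewalInt_pos N u
  set R := renewalInt N u
  obtain ⟨A, hA, σ, hσ, hστ, hdec⟩ := R_decay_exp hu_nonneg hu_sum hu_gcd hneg h0 hrec τ hτ
  have hJ := J_ge_one hu_nonneg hu_sum
  set J := ∑ k ∈ Finset.Icc 1 N, (k : ℝ) * u k
  have hr1 : Real.exp (-τ) < 1 := by rw [Real.exp_lt_one_iff]; linarith
  set B := (1 - Real.exp (-τ))⁻¹ with hB
  have hB0 : 0 ≤ B := inv_nonneg.2 (by linarith)
  have hJ1 : 1 / J ≤ 1 := by rw [div_le_one (by linarith)]; exact hJ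
  have hJ0 : 0 ≤ 1 / J := by positivity
  refine ⟨fun t => (A * (|t| + 1) + B) * Real.exp (-σ * t), by fun_prop,
    fun t => by positivity, ?_, ?_⟩
  · have h1 := tendsto_rpow_mul_exp_neg_mul_atTop_nhds_zero 1 σ hσ
    have h2 := tendsto_rpow_mul_exp_neg_mul_atTop_nhds_zero 0 σ hσ
    have h3 := (h1.const_mul A).add (h2.const_mul (A + B))
    simp only [mul_zero, add_zero] at h3
    refine h3.congr' ?_
    filter_upwards [eventually_ge_atTop 0] with t ht
    rw [abs_of_nonneg ht, Real.rpow_one, Real.rpow_zero]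
    ring
  · intro X P hP hXc hX hXb
    have hS0 : ∀ t : ℝ, t < 0 → renewalSol R X t = 0 := by
      intro t ht
      rw [renewalSol_eq R X hX t 0 (by simpa using ht.le)]; simp
    have hSr := renewalSol_rec hneg h0 hrec X hX
    refine ⟨⟨renewalSol R X, ⟨renewalSol_continuous R X hX hXc, hS0, fun t _ => hSr t⟩, ?_⟩, ?_⟩
    · rintro Y ⟨_, hY0, hYr⟩
      exact renewal_unique hY0 hS0 hYr (fun t _ => hSr t)
    · intro Z _ hZ0 hZr t ht
      have hZ : Z = renewalSol R X := renewal_unique hZ0 hS0 hZr (fun t _ => hSr t)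
      have hK : t ≤ (⌊t⌋₊ + 1 : ℕ) := by
        push_cast; exact (Nat.lt_floor_add_one t).le
      obtain ⟨E, hE, hsum⟩ := tsum_split hτ hX hXb hP t ht _ hK
      rw [hZ, hsum, renewalSol_eq R X hX t _ hK]
      have hsplit : ∑ n ∈ Finset.range (⌊t⌋₊ + 1), R n * X (t - n)
          - 1 / J * (∑ n ∈ Finset.range (⌊t⌋₊ + 1), X (t - n) + E)
          = ∑ n ∈ Finset.range (⌊t⌋₊ + 1), (R n - 1 / J) * X (t - n) - 1 / J * E := by
        simp only [sub_mul, Finset.sum_sub_distrib, Finset.mul_sum, mul_add]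
        ring
      rw [hsplit]
      have hexp : Real.exp (-τ * t) ≤ Real.exp (-σ * t) := by
        rw [Real.exp_le_exp]; nlinarith
      have hE2 : |1 / J * E| ≤ P * (B * Real.exp (-σ * t)) := by
        rw [abs_mul, abs_of_nonneg hJ0]
        calc _ ≤ 1 * |E| := mul_le_mul_of_nonneg_right hJ1 (abs_nonneg _)
          _ ≤ P * (B * Real.exp (-τ * t)) := by rw [one_mul]; exact hE
          _ ≤ _ := by gcongr
      have hterm : ∀ n ∈ Finset.range (⌊t⌋₊ + 1),
          |(R n - 1 / J) * X (t - n)| ≤ P * (A * Real.exp (-σ * t)) := by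
        intro n hn
        rw [Finset.mem_range] at hn
        have hnt : (n : ℝ) ≤ t := (Nat.le_floor_iff ht).1 (by omega)
        rw [abs_mul]
        calc _ ≤ (A * Real.exp (-σ * n)) * (P * Real.exp (-τ * (t - n))) :=
              mul_le_mul (hdec n) (hXb _ (by linarith)) (abs_nonneg _) (by positivity)
          _ = P * (A * Real.exp (-σ * n + -τ * (t - n))) := by rw [Real.exp_add]; ring
          _ ≤ _ := by
            gcongr
            nlinarith
      have hmain : |∑ n ∈ Finset.range (⌊t⌋₊ + 1), (R n - 1 / J) * X (t - n)|
          ≤ (t + 1) * (P * (A * Real.exp (-σ * t))) := by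
        refine (Finset.abs_sum_le_sum_abs _ _).trans ((Finset.sum_le_card_nsmul _ _ _ hterm).trans ?_)
        rw [nsmul_eq_mul, Finset.card_range]
        push_cast
        gcongr
        exact Nat.floor_le ht
      refine (abs_sub _ _).trans ((add_le_add hmain hE2).trans (le_of_eq ?_))
      simp only [abs_of_nonneg ht]
      ring
end

section
/- Let τ > 0 be fixed, and let u_1,…,u_N and v_1,…,v_N be nonnegative reals with ∑_{k=1}^N (u_k + v_k) = 1 and ∑_{k=1}^N v_k > 0, such that the greatest common divisor of the set of indices k with u_k + v_k > 0 equals 1, and such that there exists either an odd k ≤ N with u_k > 0 or an even k ≤ N with v_k > 0. Let X_1, X_2 : ℝ → ℝ be continuous with X_j(t) = 0 for all t ≤ 0 and |X_j(t)| ≤ Π_j e^{−τ t} for all t ≥ 0, where Π_1, Π_2 > 0. Then there exists a unique pair of continuous functions Z_1, Z_2 : ℝ → ℝ with Z_j(t) = 0 for all t < 0 and Z_j(t) = X_j(t) + ∑_{k=1}^N (u_k Z_j(t−k) + v_k Z_{3−j}(t−k)) for all t ≥ 0 (j = 1, 2). Moreover, there is a continuous function C : ℝ⁺ → ℝ⁺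 tending to 0 at +∞, depending only on τ, N, the u_k and the v_k (not on X_1, X_2, Π_1, Π_2), such that for j = 1, 2 and all t ≥ 0, |Z_j(t) − s(t)| ≤ (Π_1 + Π_2) · C(t), where s is the continuous 1-periodic function s(t) = (1/(2J)) ∑_{k=−∞}^{+∞} (X_1(t−k) + X_2(t−k)) and J = ∑_{k=1}^N k (u_k + v_k). -/
open Filter

theorem ps_mul_summable (f g : PowerSeries ℂ) (hf : Summable fun n => ‖PowerSeries.coeff n f‖)
    (hg : Summable fun n => ‖PowerSeries.coeff n g‖) :
    Summable fun n => ‖PowerSeries.coeff n (f * g)‖ := by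
  simp only [PowerSeries.coeff_mul]
  exact summable_norm_sum_mul_antidiagonal_of_summable_norm (f := fun n => PowerSeries.coeff n f)
    (g := fun n => PowerSeries.coeff n g) hf hg

theorem ps_lin (a : ℂ) (ha : 1 < ‖a‖) : ∃ g : PowerSeries ℂ,
    ((Polynomial.X - Polynomial.C a : Polynomial ℂ) : PowerSeries ℂ) * g = 1 ∧
    Summable fun n => ‖PowerSeries.coeff n g‖ := by
  have h0 : a ≠ 0 := by rintro rfl; simp at ha; linarith
  refine ⟨PowerSeries.mk fun n => - (a⁻¹) ^ (n+1), ?_, ?_⟩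
  · ext n
    simp only [Polynomial.coe_sub, Polynomial.coe_X, Polynomial.coe_C, sub_mul, map_sub,
      PowerSeries.coeff_C_mul, PowerSeries.coeff_mk]
    rcases n with _ | n
    · simp [h0]
    · rw [PowerSeries.coeff_succ_X_mul]
      simp [PowerSeries.coeff_one]
      field_simp
      ring
  · simp only [PowerSeries.coeff_mk, norm_neg, norm_pow]
    have : Summable fun n => ‖a⁻¹‖ ^ n := summable_geometric_of_lt_one (norm_nonneg _) (by
      rw [norm_inv]; exact inv_lt_one_of_one_lt₀ ha)
    exact (summable_nat_add_iff 1).2 this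

theorem ps_cplx (R : Polynomial ℂ) (hR : ∀ z : ℂ, ‖z‖ ≤ 1 → R.eval z ≠ 0) :
    ∃ g : PowerSeries ℂ, (R : PowerSeries ℂ) * g = 1 ∧
    Summable fun n => ‖PowerSeries.coeff n g‖ := by
  have hR0 : R ≠ 0 := by rintro rfl; exact hR 0 (by simp) (by simp)
  have hs := (IsAlgClosed.splits R).eq_prod_roots
  have key : ∀ m : Multiset ℂ, (∀ a ∈ m, 1 < ‖a‖) → ∃ g : PowerSeries ℂ,
      (((m.map (fun a => Polynomial.X - Polynomial.C a)).prod : Polynomial ℂ) : PowerSeries ℂ) * g = 1 ∧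
      Summable fun n => ‖PowerSeries.coeff n g‖ := by
    intro m
    induction m using Multiset.induction with
    | empty => 
      intro _
      refine ⟨1, by simp, ?_⟩
      apply summable_of_ne_finset_zero (s := {0})
      intro b hb
      simp at hb
      simp [PowerSeries.coeff_one, hb]
    | cons a m ih =>
      intro h
      obtain ⟨g, hg, hs⟩ := ih (fun b hb => h b (Multiset.mem_cons_of_mem hb))
      obtain ⟨g', hg', hs'⟩ := ps_lin a (h a (Multiset.mem_cons_self _ _))
      refine ⟨g' * g, ?_, ps_mul_summable _ _ hs' hs⟩
      rw [Multiset.map_cons, Multiset.prod_cons, Polynomial.coe_mul]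
      linear_combination (((m.map (fun a => Polynomial.X - Polynomial.C a)).prod : Polynomial ℂ) * g) * hg' + hg
  obtain ⟨g, hg, hsum⟩ := key R.roots (by
    intro a ha
    by_contra hlt
    exact hR a (not_lt.1 hlt) (Polynomial.isRoot_of_mem_roots ha))
  have hl : R.leadingCoeff ≠ 0 := Polynomial.leadingCoeff_ne_zero.2 hR0
  refine ⟨PowerSeries.C (R.leadingCoeff⁻¹) * g, ?_, ?_⟩
  · have h1 : (R : PowerSeries ℂ) = PowerSeries.C R.leadingCoeff * ((R.roots.map (fun a => Polynomial.X - Polynomial.C a)).prod : Polynomial ℂ) := by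
      conv_lhs => rw [hs]
      rw [Polynomial.coe_mul, Polynomial.coe_C]
    have h2 : (PowerSeries.C R.leadingCoeff : PowerSeries ℂ) * PowerSeries.C (R.leadingCoeff⁻¹) = 1 := by
      rw [← map_mul, mul_inv_cancel₀ hl, map_one]
    rw [h1]
    linear_combination (((R.roots.map (fun a => Polynomial.X - Polynomial.C a)).prod : Polynomial ℂ) * g) * h2 + hg
  · simp only [PowerSeries.coeff_C_mul, norm_mul]
    exact hsum.mul_left _

theorem ps_real (R : Polynomial ℝ) (hR : ∀ z : ℂ, ‖z‖ ≤ 1 → Polynomial.aeval z R ≠ 0) :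
    ∃ g : PowerSeries ℝ, (R : PowerSeries ℝ) * g = 1 ∧
    Summable fun n => |PowerSeries.coeff n g| := by
  obtain ⟨G, hG, hs⟩ := ps_cplx (R.map (algebraMap ℝ ℂ)) (by
    intro z hz; rw [Polynomial.eval_map_algebraMap]; exact hR z hz)
  have h0 : R.coeff 0 ≠ 0 := by
    intro h
    apply hR 0 (by simp)
    rw [← Polynomial.coeff_zero_eq_aeval_zero', h]; simp
  have h1 : (R : PowerSeries ℝ) * (R : PowerSeries ℝ)⁻¹ = 1 :=
    PowerSeries.mul_inv_cancel _ (by simpa using h0)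
  refine ⟨_, h1, ?_⟩
  have h2 : PowerSeries.map (algebraMap ℝ ℂ) ((R : PowerSeries ℝ)⁻¹) = G := by
    have h3 := congrArg (PowerSeries.map (algebraMap ℝ ℂ)) h1
    rw [map_mul, map_one, ← Polynomial.polynomial_map_coe] at h3
    linear_combination G * h3 - PowerSeries.map (algebraMap ℝ ℂ) ((R : PowerSeries ℝ)⁻¹) * hG
  refine hs.congr ?_
  intro n
  rw [← h2, PowerSeries.coeff_map]
  simp

theorem root_lem (N : ℕ) (u v : ℕ → ℝ)
    (hu : ∀ k ∈ Finset.Icc 1 N, 0 ≤ u k) (hv : ∀ k ∈ Finset.Icc 1 N, 0 ≤ v k)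
    (hs : ∑ k ∈ Finset.Icc 1 N, (u k + v k) = 1) (z : ℂ) (hz : ‖z‖ ≤ 1)
    (h : ∑ k ∈ Finset.Icc 1 N, ((u k - v k : ℝ) : ℂ) * z ^ k = 1) :
    ∀ k ∈ Finset.Icc 1 N, (0 < u k → z ^ k = 1) ∧ (0 < v k → z ^ k = -1) := by
  have hb : ∀ k, ‖z ^ k‖ ≤ 1 := fun k => by rw [norm_pow]; exact pow_le_one₀ (norm_nonneg _) hz
  have hre : ∀ w : ℂ, ‖w‖ ≤ 1 → w.re = 1 → w = 1 := by
    intro w hw h1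
    have := Complex.sq_norm w
    rw [Complex.normSq_apply, h1] at this
    have h2 : w.im = 0 := by nlinarith [norm_nonneg w]
    apply Complex.ext <;> simp [h1, h2]
  have h' := congrArg Complex.re h
  rw [Complex.re_sum] at h'
  simp only [Complex.re_ofReal_mul, Complex.one_re] at h'
  have hab : ∀ k, |(z^k).re| ≤ 1 := fun k => (Complex.abs_re_le_norm _).trans (hb k)
  have hsum : ∑ k ∈ Finset.Icc 1 N, (u k * (1 - (z^k).re) + v k * (1 + (z^k).re)) = 0 := by
    have : ∑ k ∈ Finset.Icc 1 N, (u k * (1 - (z^k).re) + v k * (1 + (z^k).re)) =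
      ∑ k ∈ Finset.Icc 1 N, (u k + v k) - ∑ k ∈ Finset.Icc 1 N, (u k - v k) * (z^k).re := by
      rw [← Finset.sum_sub_distrib]; apply Finset.sum_congr rfl; intros; ring
    rw [this, hs, h']; ring
  have hnn1 : ∀ k ∈ Finset.Icc 1 N, 0 ≤ u k * (1 - (z^k).re) := fun k hk =>
    mul_nonneg (hu k hk) (by linarith [(abs_le.1 (hab k)).2])
  have hnn2 : ∀ k ∈ Finset.Icc 1 N, 0 ≤ v k * (1 + (z^k).re) := fun k hk =>
    mul_nonneg (hv k hk) (by linarith [(abs_le.1 (hab k)).1])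
  rw [Finset.sum_eq_zero_iff_of_nonneg (fun k hk => add_nonneg (hnn1 k hk) (hnn2 k hk))] at hsum
  intro k hk
  have e := hsum k hk
  have e1 := hnn1 k hk
  have e2 := hnn2 k hk
  constructor
  · intro hp
    have : u k * (1 - (z^k).re) = 0 := by linarith
    apply hre _ (hb k)
    have := (mul_eq_zero.1 this).resolve_left hp.ne'
    linarith
  · intro hp
    have : v k * (1 + (z^k).re) = 0 := by linarith
    have := (mul_eq_zero.1 this).resolve_left hp.ne'
    have := hre (-z^k) (by rw [norm_neg]; exact hb k) (by simp; linarith)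
    linear_combination -this

noncomputable def zext (g : PowerSeries ℝ) (n : ℤ) : ℝ :=
  if 0 ≤ n then PowerSeries.coeff n.toNat g else 0

theorem zext_rec (N : ℕ) (c : ℕ → ℝ) (g : PowerSeries ℝ)
    (hg : ((1 - ∑ k ∈ Finset.Icc 1 N, Polynomial.C (c k) * Polynomial.X ^ k : Polynomial ℝ) : PowerSeries ℝ) * g = 1)
    (n : ℤ) : zext g n = (if n = 0 then 1 else 0) + ∑ k ∈ Finset.Icc 1 N, c k * zext g (n - k) := by
  rcases lt_or_ge n 0 with hn | hn
  · rw [zext, if_neg (by omega), if_neg (by omega), Finset.sum_eq_zero]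
    · simp
    · intro k hk
      rw [zext, if_neg (by omega), mul_zero]
  · lift n to ℕ using hn
    have h1 : g = 1 + ∑ k ∈ Finset.Icc 1 N, PowerSeries.C (c k) * (PowerSeries.X ^ k * g) := by
      have : ((∑ k ∈ Finset.Icc 1 N, Polynomial.C (c k) * Polynomial.X ^ k : Polynomial ℝ) : PowerSeries ℝ)
          = ∑ k ∈ Finset.Icc 1 N, PowerSeries.C (c k) * PowerSeries.X ^ k := by
        rw [← Polynomial.coeToPowerSeries.ringHom_apply, map_sum]
        simp [Polynomial.coeToPowerSeries.ringHom_apply]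
      rw [Polynomial.coe_sub, Polynomial.coe_one, this] at hg
      simp only [← mul_assoc]
      rw [← Finset.sum_mul]
      linear_combination hg
    have h2 := congrArg (PowerSeries.coeff n) h1
    rw [map_add, map_sum] at h2
    simp only [PowerSeries.coeff_C_mul, PowerSeries.coeff_X_pow_mul', PowerSeries.coeff_one] at h2
    rw [zext, if_pos (by omega), Int.toNat_natCast, h2]
    congr 1
    · simp
    · apply Finset.sum_congr rfl
      intro k hk
      congr 1
      rw [zext]
      by_cases hkn : k ≤ n
      · rw [if_pos hkn, if_pos (by omega)]
        congr 2; omega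
      · rw [if_neg hkn, if_neg (by omega)]

noncomputable def zconv (w : ℤ → ℝ) (Y : ℝ → ℝ) (t : ℝ) : ℝ := ∑' n : ℤ, w n * Y (t - n)

theorem zconv_eq (w : ℤ → ℝ) (Y : ℝ → ℝ) (hw : ∀ n < 0, w n = 0) (hY : ∀ t ≤ 0, Y t = 0)
    (M : ℕ) (t : ℝ) (ht : t ≤ M) :
    zconv w Y t = ∑ n ∈ Finset.Ico (0:ℤ) M, w n * Y (t - n) := by
  apply tsum_eq_sum
  intro n hn
  rw [Finset.mem_Ico, not_and_or] at hn
  rcases hn with hn | hn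
  · rw [hw n (by omega), zero_mul]
  · rw [hY, mul_zero]
    have : ((M:ℤ):ℝ) ≤ n := by exact_mod_cast not_lt.1 hn
    push_cast at this
    linarith

theorem zconv_summable (w : ℤ → ℝ) (Y : ℝ → ℝ) (hw : ∀ n < 0, w n = 0) (hY : ∀ t ≤ 0, Y t = 0)
    (t : ℝ) : Summable fun n : ℤ => w n * Y (t - n) := by
  obtain ⟨M, ht⟩ := exists_nat_ge t
  apply summable_of_ne_finset_zero (s := Finset.Ico (0:ℤ) M)
  intro n hn
  rw [Finset.mem_Ico, not_and_or] at hn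
  rcases hn with hn | hn
  · rw [hw n (by omega), zero_mul]
  · rw [hY, mul_zero]
    have : ((M:ℤ):ℝ) ≤ n := by exact_mod_cast not_lt.1 hn
    push_cast at this
    linarith

theorem zconv_cont (w : ℤ → ℝ) (Y : ℝ → ℝ) (hw : ∀ n < 0, w n = 0) (hY : ∀ t ≤ 0, Y t = 0)
    (hc : Continuous Y) : Continuous (zconv w Y) := by
  rw [continuous_iff_continuousAt]
  intro t
  obtain ⟨M, ht⟩ := exists_nat_gt t
  have h : ContinuousAt (fun t : ℝ => ∑ n ∈ Finset.Ico (0:ℤ) M, w n * Y (t - n)) t := by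
    apply Continuous.continuousAt
    fun_prop
  refine h.congr ?_
  filter_upwards [Iio_mem_nhds ht] with s hs
  exact (zconv_eq w Y hw hY M s (le_of_lt hs)).symm

theorem zconv_zero (w : ℤ → ℝ) (Y : ℝ → ℝ) (hw : ∀ n < 0, w n = 0) (hY : ∀ t ≤ 0, Y t = 0)
    (t : ℝ) (ht : t ≤ 0) : zconv w Y t = 0 := by
  rw [zconv_eq w Y hw hY 0 t (by simpa using ht)]; simp

theorem zconv_rec (N : ℕ) (c : ℕ → ℝ) (w : ℤ → ℝ) (Y : ℝ → ℝ) (hw : ∀ n < 0, w n = 0)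
    (hY : ∀ t ≤ 0, Y t = 0)
    (hrec : ∀ n : ℤ, w n = (if n = 0 then 1 else 0) + ∑ k ∈ Finset.Icc 1 N, c k * w (n - k)) (t : ℝ) :
    zconv w Y t = Y t + ∑ k ∈ Finset.Icc 1 N, c k * zconv w Y (t - k) := by
  have hsh : ∀ k : ℕ, HasSum (fun n : ℤ => w (n - k) * Y (t - n)) (zconv w Y (t - k)) := by
    intro k
    have := (zconv_summable w Y hw hY (t - k)).hasSum
    rw [← (Equiv.subRight (k:ℤ)).hasSum_iff] at this
    rw [zconv]
    convert this using 2 with n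
    simp [Function.comp]
  have h1 : HasSum (fun n : ℤ => (if n = 0 then 1 else 0) * Y (t - n)) (Y t) := by
    convert hasSum_ite_eq (0:ℤ) (Y t) using 2 with n
    split_ifs with h
    · simp [h]
    · simp
  have h2 := h1.add (hasSum_sum (s := Finset.Icc 1 N) (fun k _ => (hsh k).mul_left (c k)))
  have h3 : HasSum (fun n : ℤ => w n * Y (t - n)) (Y t + ∑ k ∈ Finset.Icc 1 N, c k * zconv w Y (t - k)) := by
    convert h2 using 2 with n
    conv_lhs => rw [hrec n]
    rw [add_mul, Finset.sum_mul]
    congr 1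
    apply Finset.sum_congr rfl
    intros; ring
  exact h3.tsum_eq

theorem uniq_lem (N : ℕ) (u v : ℕ → ℝ) (F G : ℝ → ℝ) (h0 : ∀ t < 0, F t = 0 ∧ G t = 0)
    (h : ∀ t : ℝ, 0 ≤ t → 
      F t = ∑ k ∈ Finset.Icc 1 N, (u k * F (t - k) + v k * G (t - k)) ∧
      G t = ∑ k ∈ Finset.Icc 1 N, (u k * G (t - k) + v k * F (t - k))) (t : ℝ) : F t = 0 ∧ G t = 0 := by
  have key : ∀ n : ℕ, ∀ t < (n:ℝ), F t = 0 ∧ G t = 0 := by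
    intro n
    induction n with
    | zero => simpa using h0
    | succ n ih =>
      intro t ht
      rcases lt_or_ge t 0 with h1 | h1
      · exact h0 t h1
      · have hz : ∀ k ∈ Finset.Icc 1 N, F (t - k) = 0 ∧ G (t - k) = 0 := by
          intro k hk
          apply ih
          have : (1:ℝ) ≤ k := by exact_mod_cast (Finset.mem_Icc.1 hk).1
          push_cast at ht
          linarith
        rw [(h t h1).1, (h t h1).2]
        constructor <;> apply Finset.sum_eq_zero <;> intro k hk <;> simp [hz k hk]
  obtain ⟨M, hM⟩ := exists_nat_gt t
  exact key M t hM

theorem maj_lem (τ : ℝ) (hτ : 0 < τ) (a : ℤ → ℝ) (ha : ∀ n, 0 ≤ a n) (hs : Summable a) :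
    let C : ℝ → ℝ := fun t => ∑' n : ℤ, a n * Real.exp (-τ * |t - ((max n 0 : ℤ) : ℝ)|)
    Continuous C ∧ (∀ t, 0 ≤ C t) ∧ Tendsto C atTop (nhds 0) ∧
    ∀ t, Summable fun n : ℤ => a n * Real.exp (-τ * |t - ((max n 0 : ℤ) : ℝ)|) := by
  have hb : ∀ n t, ‖a n * Real.exp (-τ * |t - ((max n 0 : ℤ) : ℝ)|)‖ ≤ a n := by
    intro n t
    rw [Real.norm_of_nonneg (mul_nonneg (ha n) (Real.exp_pos _).le)]
    apply mul_le_of_le_one_right (ha n)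
    rw [Real.exp_le_one_iff]
    have := mul_nonneg hτ.le (abs_nonneg (t - ((max n 0 : ℤ) : ℝ)))
    linarith
  intro C
  refine ⟨?_, ?_, ?_, ?_⟩
  · exact continuous_tsum (fun n => by fun_prop) hs hb
  · intro t
    exact tsum_nonneg fun n => mul_nonneg (ha n) (Real.exp_pos _).le
  · have : (0:ℝ) = ∑' n : ℤ, (0:ℝ) := by simp
    rw [this]
    apply tendsto_tsum_of_dominated_convergence hs
    · intro n
      rw [← mul_zero (a n)]
      apply Tendsto.const_mul
      apply Real.tendsto_exp_atBot.comp
      apply Tendsto.const_mul_atTop_of_neg (by linarith)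
      exact tendsto_abs_atTop_atTop.comp (tendsto_atTop_add_const_right _ _ tendsto_id)
    · exact Eventually.of_forall fun t n => hb n t
  · intro t
    exact Summable.of_norm_bounded hs (fun n => hb n t)

theorem aeval_lem (N : ℕ) (c : ℕ → ℝ) (z : ℂ) :
    Polynomial.aeval z (1 - ∑ k ∈ Finset.Icc 1 N, Polynomial.C (c k) * Polynomial.X ^ k : Polynomial ℝ)
      = 1 - ∑ k ∈ Finset.Icc 1 N, (c k : ℂ) * z ^ k := by
  simp

theorem D_lem (N : ℕ) (u v : ℕ → ℝ)
    (hu_nonneg : ∀ k ∈ Finset.Icc 1 N, 0 ≤ u k)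
    (hv_nonneg : ∀ k ∈ Finset.Icc 1 N, 0 ≤ v k)
    (huv_sum : ∑ k ∈ Finset.Icc 1 N, (u k + v k) = 1)
    (hv_pos : 0 < ∑ k ∈ Finset.Icc 1 N, v k)
    (huv_gcd : ((Finset.Icc 1 N).filter (fun k => 0 < u k + v k)).gcd id = 1)
    (hparity : ∃ k ∈ Finset.Icc 1 N, (Odd k ∧ 0 < u k) ∨ (Even k ∧ 0 < v k)) :
    ∃ g : PowerSeries ℝ,
      ((1 - ∑ k ∈ Finset.Icc 1 N, Polynomial.C (u k - v k) * Polynomial.X ^ k : Polynomial ℝ) : PowerSeries ℝ) * g = 1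
      ∧ Summable fun n => |PowerSeries.coeff n g| := by
  apply ps_real
  intro z hz h
  rw [aeval_lem N (fun k => u k - v k)] at h
  have hr := root_lem N u v hu_nonneg hv_nonneg huv_sum z hz (sub_eq_zero.1 h).symm
  have h2 : orderOf (z ^ 2) ∣ 1 := by
    rw [← huv_gcd]
    apply Finset.dvd_gcd
    intro k hk
    rw [Finset.mem_filter] at hk
    apply orderOf_dvd_of_pow_eq_one
    rw [id, ← pow_mul, mul_comm, pow_mul]
    rcases (hu_nonneg k hk.1).lt_or_eq with h3 | h3
    · rw [(hr k hk.1).1 h3]; simp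
    · rw [(hr k hk.1).2 (by linarith [hk.2])]; simp
  rw [Nat.dvd_one, orderOf_eq_one_iff] at h2
  rcases eq_or_eq_neg_of_sq_eq_sq z 1 (by rw [h2, one_pow]) with rfl | rfl
  · obtain ⟨k, hk, hk'⟩ := Finset.exists_lt_of_sum_lt (by simpa using hv_pos : ∑ k ∈ Finset.Icc 1 N, (0:ℝ) < _)
    have := (hr k hk).2 hk'
    norm_num at this
  · obtain ⟨k, hk, ⟨h3, h4⟩ | ⟨h3, h4⟩⟩ := hparity
    · have := (hr k hk).1 h4
      rw [h3.neg_one_pow] at this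
      norm_num at this
    · have := (hr k hk).2 h4
      rw [h3.neg_one_pow] at this
      norm_num at this

theorem A_lem (N : ℕ) (p : ℕ → ℝ)
    (hp : ∀ k ∈ Finset.Icc 1 N, 0 ≤ p k)
    (hsum : ∑ k ∈ Finset.Icc 1 N, p k = 1)
    (hgcd : ((Finset.Icc 1 N).filter (fun k => 0 < p k)).gcd id = 1)
    (hJ : 0 < ∑ k ∈ Finset.Icc 1 N, (k : ℝ) * p k) :
    ∃ g : PowerSeries ℝ,
      ((1 - ∑ k ∈ Finset.Icc 1 N, Polynomial.C (p k) * Polynomial.X ^ k : Polynomial ℝ) : PowerSeries ℝ) * g = 1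
      ∧ Summable fun n => |PowerSeries.coeff n g - 1 / ∑ k ∈ Finset.Icc 1 N, (k : ℝ) * p k| := by
  set J := ∑ k ∈ Finset.Icc 1 N, (k : ℝ) * p k with hJdef
  set R : Polynomial ℝ := 1 - ∑ k ∈ Finset.Icc 1 N, Polynomial.C (p k) * Polynomial.X ^ k with hRdef
  have hR1 : R.eval 1 = 0 := by simp [hRdef, Polynomial.eval_finsetSum, hsum]
  have hR' : R.derivative.eval 1 = -J := by
    simp only [hRdef, hJdef, Polynomial.derivative_sub, Polynomial.derivative_one, Polynomial.derivative_sum,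
      Polynomial.derivative_C_mul_X_pow, Polynomial.eval_sub, Polynomial.eval_finsetSum, zero_sub,
      Polynomial.eval_neg, Polynomial.eval_mul, Polynomial.eval_C, Polynomial.eval_pow, Polynomial.eval_X, one_pow, mul_one]
    congr 1
    exact Finset.sum_congr rfl fun k _ => mul_comm _ _
  obtain ⟨Q', hQ'⟩ := Polynomial.dvd_iff_isRoot.2 (hR1 : R.IsRoot 1)
  obtain ⟨Q, rfl⟩ : ∃ Q, Q' = -Q := ⟨-Q', by simp⟩
  have hQ : R = (1 - Polynomial.X) * Q := by rw [hQ']; simp; ring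
  have hQ1 : Q.eval 1 = J := by
    rw [hQ] at hR'
    simp at hR'
    linarith
  have hroot : (Polynomial.C J - Q).IsRoot 1 := by simp [hQ1]
  obtain ⟨S', hS'⟩ := Polynomial.dvd_iff_isRoot.2 hroot
  obtain ⟨S, rfl⟩ : ∃ S, S' = -S := ⟨-S', by simp⟩
  have hS : Polynomial.C J - Q = (1 - Polynomial.X) * S := by rw [hS']; simp; ring
  obtain ⟨G, hG, hGs⟩ := ps_real Q (by
    intro z hz h
    by_cases hz1 : z = 1
    · subst hz1
      have : Polynomial.aeval (1:ℂ) Q = ((Q.eval 1 : ℝ) : ℂ) := by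
        have := Polynomial.aeval_algebraMap_apply_eq_algebraMap_eval (A := ℂ) (1:ℝ) Q
        simpa using this
      rw [this, hQ1] at h
      exact hJ.ne' (by exact_mod_cast h)
    · have hRz : Polynomial.aeval z R = 0 := by rw [hQ, map_mul, h, mul_zero]
      rw [hRdef, aeval_lem] at hRz
      have hr := root_lem N p (fun _ => 0) hp (by simp) (by simpa using hsum) z hz (by
        simpa using (sub_eq_zero.1 hRz).symm)
      apply hz1
      have h2 : orderOf z ∣ 1 := by
        rw [← hgcd]
        apply Finset.dvd_gcd
        intro k hk
        rw [Finset.mem_filter] at hk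
        exact orderOf_dvd_of_pow_eq_one ((hr k hk.1).1 hk.2)
      rwa [Nat.dvd_one, orderOf_eq_one_iff] at h2)
  have hone : (PowerSeries.mk 1 : PowerSeries ℝ) * (1 - PowerSeries.X) = 1 :=
    PowerSeries.mk_one_mul_one_sub_eq_one ℝ
  have hJC : (PowerSeries.C (1/J) : PowerSeries ℝ) * PowerSeries.C J = 1 := by
    rw [← map_mul, one_div, inv_mul_cancel₀ hJ.ne', map_one]
  have hQP : (R : PowerSeries ℝ) = (1 - PowerSeries.X) * (Q : PowerSeries ℝ) := by rw [hQ]; simp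
  have hSP : PowerSeries.C J - (Q : PowerSeries ℝ) = (1 - PowerSeries.X) * (S : PowerSeries ℝ) := by
    have := congrArg (fun P : Polynomial ℝ => (P : PowerSeries ℝ)) hS
    simpa using this
  refine ⟨PowerSeries.C (1/J) * (PowerSeries.mk 1 + (S : PowerSeries ℝ) * G), ?_, ?_⟩
  · rw [hQP]
    linear_combination (PowerSeries.C (1/J) * (Q : PowerSeries ℝ)) * hone
      + (PowerSeries.C (1/J) * (1 - PowerSeries.X) * (S : PowerSeries ℝ)) * hG
      - (PowerSeries.C (1/J) : PowerSeries ℝ) * hSP + hJC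
  · have hSs : Summable fun n => ‖PowerSeries.coeff n (S : PowerSeries ℝ)‖ := by
      apply summable_of_ne_finset_zero (s := S.support)
      intro b hb
      simpa using hb
    have hSG : Summable fun n => ‖PowerSeries.coeff n ((S : PowerSeries ℝ) * G)‖ := by
      simp only [PowerSeries.coeff_mul]
      exact summable_norm_sum_mul_antidiagonal_of_summable_norm
        (f := fun n => PowerSeries.coeff n (S : PowerSeries ℝ))
        (g := fun n => PowerSeries.coeff n G) hSs hGs
    refine (hSG.mul_left |1/J|).congr ?_
    intro n
    rw [PowerSeries.coeff_C_mul, map_add, PowerSeries.coeff_mk, Real.norm_eq_abs, ← abs_mul]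
    congr 1
    simp
    ring

theorem zext_summable (τ : ℝ) (hτ : 0 < τ) (g : PowerSeries ℝ) (b : ℝ) 
    (h : Summable fun n => |PowerSeries.coeff n g - b|) :
    Summable fun n : ℤ => |zext g n - b| * Real.exp (τ * (min n 0 : ℤ)) := by
  apply Summable.of_nat_of_neg
  · refine h.congr ?_
    intro n
    simp [zext]
  · have hgeo : Summable fun n : ℕ => (Real.exp (-τ)) ^ n := 
      summable_geometric_of_lt_one (Real.exp_pos _).le (by rw [Real.exp_lt_one_iff]; linarith)
    have h2 := hgeo.mul_left |b|
    rw [← summable_nat_add_iff 1] at h2 ⊢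
    refine h2.congr ?_
    intro n
    rw [zext, if_neg (by omega), zero_sub, abs_neg, ← Real.exp_nat_mul, min_eq_left (by omega)]
    congr 2
    push_cast; ring

/-- main pointwise estimate -/
theorem est_lem (τ : ℝ) (hτ : 0 < τ) (w : ℤ → ℝ) (hw : ∀ n < 0, w n = 0) (b Pi : ℝ)
    (hs : Summable fun n : ℤ => |w n - b| * Real.exp (τ * (min n 0 : ℤ)))
    (Y : ℝ → ℝ) (hY : ∀ t ≤ 0, Y t = 0) (hYb : ∀ t : ℝ, 0 ≤ t → |Y t| ≤ Pi * Real.exp (-τ * t))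
    (hPi : 0 ≤ Pi) (t : ℝ) (ht : 0 ≤ t) :
    |zconv w Y t - b * ∑' n : ℤ, Y (t - n)| ≤ Pi * ∑' n : ℤ, |w n - b| * Real.exp (τ * (min n 0 : ℤ)) *
      Real.exp (-τ * |t - ((max n 0 : ℤ) : ℝ)|) := by
  obtain ⟨-, -, -, hsm⟩ := maj_lem τ hτ _ (fun n => by positivity) hs
  have hterm : ∀ n : ℤ, ‖(w n - b) * Y (t - n)‖ ≤ Pi * (|w n - b| * Real.exp (τ * (min n 0 : ℤ)) *
      Real.exp (-τ * |t - ((max n 0 : ℤ) : ℝ)|)) := by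
    intro n
    rw [norm_mul, Real.norm_eq_abs, Real.norm_eq_abs]
    have : |Y (t - n)| ≤ Pi * (Real.exp (τ * (min n 0 : ℤ)) *
      Real.exp (-τ * |t - ((max n 0 : ℤ) : ℝ)|)) := by
      rcases le_or_gt (t - n) 0 with h | h
      · rw [hY _ h, abs_zero]; positivity
      · refine (hYb _ h.le).trans (le_of_eq ?_)
        rw [← Real.exp_add]
        congr 2
        rcases le_total n 0 with hn | hn
        · rw [min_eq_left hn, max_eq_right hn, Int.cast_zero, sub_zero, abs_of_nonneg ht]; ring
        · rw [min_eq_right hn, max_eq_left hn, abs_of_pos h]; simp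
    calc _ ≤ |w n - b| * _ := mul_le_mul_of_nonneg_left this (abs_nonneg _)
      _ = _ := by ring
  have hsum1 : Summable fun n : ℤ => (w n - b) * Y (t - n) :=
    Summable.of_norm_bounded ((hsm t).mul_left Pi) hterm
  have heq : zconv w Y t - b * ∑' n : ℤ, Y (t - n) = ∑' n : ℤ, (w n - b) * Y (t - n) := by
    have h1 := zconv_summable w Y hw hY t
    have h2 : Summable fun n : ℤ => b * Y (t - n) := by
      refine (h1.sub hsum1).congr ?_
      intro n; ring
    rw [zconv, ← tsum_mul_left, ← h1.tsum_sub h2]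
    congr 1; ext n; ring
  rw [heq, ← tsum_mul_left]
  exact tsum_of_norm_bounded ((hsm t).mul_left Pi).hasSum hterm

/-- two-component renewal theorem with remainder estimate.
`s(t) = (1/(2J)) ∑_{k ∈ ℤ} (X₁(t - k) + X₂(t - k))` is written with a `tsum` over `ℤ`. -/
theorem stmt_3
    (τ : ℝ) (hτ : 0 < τ)
    (N : ℕ) (u v : ℕ → ℝ)
    (hu_nonneg : ∀ k ∈ Finset.Icc 1 N, 0 ≤ u k)
    (hv_nonneg : ∀ k ∈ Finset.Icc 1 N, 0 ≤ v k)
    (huv_sum : ∑ k ∈ Finset.Icc 1 N, (u k + v k) = 1)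
    (hv_pos : 0 < ∑ k ∈ Finset.Icc 1 N, v k)
    (huv_gcd : ((Finset.Icc 1 N).filter (fun k => 0 < u k + v k)).gcd id = 1)
    (hparity : ∃ k ∈ Finset.Icc 1 N, (Odd k ∧ 0 < u k) ∨ (Even k ∧ 0 < v k)) :
    ∃ C : ℝ → ℝ, Continuous C ∧ (∀ t, 0 ≤ C t) ∧ Tendsto C atTop (nhds 0) ∧
      ∀ (X₁ X₂ : ℝ → ℝ) (Pi₁ Pi₂ : ℝ), 0 < Pi₁ → 0 < Pi₂ →
        Continuous X₁ → Continuous X₂ →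
        (∀ t : ℝ, t ≤ 0 → X₁ t = 0) → (∀ t : ℝ, t ≤ 0 → X₂ t = 0) →
        (∀ t : ℝ, 0 ≤ t → |X₁ t| ≤ Pi₁ * Real.exp (-τ * t)) →
        (∀ t : ℝ, 0 ≤ t → |X₂ t| ≤ Pi₂ * Real.exp (-τ * t)) →
        (∃! Zp : (ℝ → ℝ) × (ℝ → ℝ),
            (Continuous Zp.1 ∧ Continuous Zp.2) ∧
            (∀ t : ℝ, t < 0 → Zp.1 t = 0 ∧ Zp.2 t = 0) ∧
            ∀ t : ℝ, 0 ≤ t →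
              Zp.1 t = X₁ t +
                  ∑ k ∈ Finset.Icc 1 N, (u k * Zp.1 (t - k) + v k * Zp.2 (t - k)) ∧
              Zp.2 t = X₂ t +
                  ∑ k ∈ Finset.Icc 1 N, (u k * Zp.2 (t - k) + v k * Zp.1 (t - k))) ∧
        (∀ Z₁ Z₂ : ℝ → ℝ,
          Continuous Z₁ → Continuous Z₂ →
          (∀ t : ℝ, t < 0 → Z₁ t = 0 ∧ Z₂ t = 0) →
          (∀ t : ℝ, 0 ≤ t →
              Z₁ t = X₁ t +
                  ∑ k ∈ Finset.Icc 1 N, (u k * Z₁ (t - k) + v k * Z₂ (t - k)) ∧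
              Z₂ t = X₂ t +
                  ∑ k ∈ Finset.Icc 1 N, (u k * Z₂ (t - k) + v k * Z₁ (t - k))) →
          ∀ t : ℝ, 0 ≤ t →
            |Z₁ t - (1 / (2 * ∑ k ∈ Finset.Icc 1 N, (k : ℝ) * (u k + v k))) *
                ∑' k : ℤ, (X₁ (t - k) + X₂ (t - k))| ≤ (Pi₁ + Pi₂) * C t ∧
            |Z₂ t - (1 / (2 * ∑ k ∈ Finset.Icc 1 N, (k : ℝ) * (u k + v k))) *
                ∑' k : ℤ, (X₁ (t - k) + X₂ (t - k))| ≤ (Pi₁ + Pi₂) * C t) := by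
  have hJ : 0 < ∑ k ∈ Finset.Icc 1 N, (k : ℝ) * (u k + v k) := by
    have h1 : ∑ k ∈ Finset.Icc 1 N, (u k + v k) ≤ ∑ k ∈ Finset.Icc 1 N, (k : ℝ) * (u k + v k) := by
      apply Finset.sum_le_sum
      intro k hk
      have h2 : (1:ℝ) ≤ k := by exact_mod_cast (Finset.mem_Icc.1 hk).1
      have h3 := add_nonneg (hu_nonneg k hk) (hv_nonneg k hk)
      nlinarith
    linarith
  obtain ⟨gD, hgD, hsD⟩ := D_lem N u v hu_nonneg hv_nonneg huv_sum hv_pos huv_gcd hparity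
  obtain ⟨gA, hgA, hsA⟩ := A_lem N (fun k => u k + v k)
    (fun k hk => add_nonneg (hu_nonneg k hk) (hv_nonneg k hk)) huv_sum huv_gcd hJ
  set J := ∑ k ∈ Finset.Icc 1 N, (k : ℝ) * (u k + v k) with hJdef
  have hzn : ∀ g : PowerSeries ℝ, ∀ n < 0, zext g n = 0 := fun g n hn => by
    rw [zext, if_neg (by omega)]
  have hA2 := zext_summable τ hτ gA (1 / J) hsA
  have hD2 := zext_summable τ hτ gD 0 (by simpa using hsD)
  obtain ⟨cA, pA, tA, -⟩ := maj_lem τ hτ _ (fun n => by positivity) hA2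
  obtain ⟨cD, pD, tD, -⟩ := maj_lem τ hτ _ (fun n => by positivity) hD2
  have hrA := zext_rec N (fun k => u k + v k) gA hgA
  have hrD := zext_rec N (fun k => u k - v k) gD hgD
  refine ⟨_, cA.add cD, fun t => add_nonneg (pA t) (pD t), by have := tA.add tD; rwa [add_zero] at this, ?_⟩
  intro X₁ X₂ Pi₁ Pi₂ hP1 hP2 hc1 hc2 hz1 hz2 hb1 hb2
  have hz3 : ∀ t ≤ 0, X₁ t + X₂ t = 0 := fun t ht => by rw [hz1 t ht, hz2 t ht, add_zero]
  have hz4 : ∀ t ≤ 0, X₁ t - X₂ t = 0 := fun t ht => by rw [hz1 t ht, hz2 t ht, sub_zero]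
  set A := zconv (zext gA) (fun t => X₁ t + X₂ t) with hA
  set D := zconv (zext gD) (fun t => X₁ t - X₂ t) with hD
  have cA' : Continuous A := zconv_cont _ _ (hzn gA) hz3 (hc1.add hc2)
  have cD' : Continuous D := zconv_cont _ _ (hzn gD) hz4 (hc1.sub hc2)
  have eA : ∀ t, A t = X₁ t + X₂ t + ∑ k ∈ Finset.Icc 1 N, (u k + v k) * A (t - k) :=
    zconv_rec N _ _ _ (hzn gA) hz3 hrA
  have eD : ∀ t, D t = X₁ t - X₂ t + ∑ k ∈ Finset.Icc 1 N, (u k - v k) * D (t - k) :=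
    zconv_rec N _ _ _ (hzn gD) hz4 hrD
  have zA : ∀ t ≤ 0, A t = 0 := zconv_zero _ _ (hzn gA) hz3
  have zD : ∀ t ≤ 0, D t = 0 := zconv_zero _ _ (hzn gD) hz4
  have esol : ∀ t : ℝ, (A t + D t) / 2 = X₁ t + ∑ k ∈ Finset.Icc 1 N,
        (u k * ((A (t - k) + D (t - k)) / 2) + v k * ((A (t - k) - D (t - k)) / 2)) ∧
      (A t - D t) / 2 = X₂ t + ∑ k ∈ Finset.Icc 1 N,
        (u k * ((A (t - k) - D (t - k)) / 2) + v k * ((A (t - k) + D (t - k)) / 2)) := by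
    intro t
    constructor
    · have h : ∑ k ∈ Finset.Icc 1 N,
          (u k * ((A (t - k) + D (t - k)) / 2) + v k * ((A (t - k) - D (t - k)) / 2)) =
          (∑ k ∈ Finset.Icc 1 N, (u k + v k) * A (t - k) +
            ∑ k ∈ Finset.Icc 1 N, (u k - v k) * D (t - k)) / 2 := by
        rw [← Finset.sum_add_distrib, Finset.sum_div]
        exact Finset.sum_congr rfl fun k _ => by ring
      rw [h]
      linear_combination (eA t + eD t) / 2
    · have h : ∑ k ∈ Finset.Icc 1 N,
          (u k * ((A (t - k) - D (t - k)) / 2) + v k * ((A (t - k) + D (t - k)) / 2)) =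
          (∑ k ∈ Finset.Icc 1 N, (u k + v k) * A (t - k) -
            ∑ k ∈ Finset.Icc 1 N, (u k - v k) * D (t - k)) / 2 := by
        rw [← Finset.sum_sub_distrib, Finset.sum_div]
        exact Finset.sum_congr rfl fun k _ => by ring
      rw [h]
      linear_combination (eA t - eD t) / 2
  have huniq : ∀ Z₁ Z₂ : ℝ → ℝ,
      (∀ t : ℝ, t < 0 → Z₁ t = 0 ∧ Z₂ t = 0) →
      (∀ t : ℝ, 0 ≤ t →
          Z₁ t = X₁ t +
              ∑ k ∈ Finset.Icc 1 N, (u k * Z₁ (t - k) + v k * Z₂ (t - k)) ∧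
          Z₂ t = X₂ t +
              ∑ k ∈ Finset.Icc 1 N, (u k * Z₂ (t - k) + v k * Z₁ (t - k))) →
      ∀ t, Z₁ t = (A t + D t) / 2 ∧ Z₂ t = (A t - D t) / 2 := by
    intro Z₁ Z₂ h0 he t
    have := uniq_lem N u v (fun t => Z₁ t - (A t + D t) / 2) (fun t => Z₂ t - (A t - D t) / 2)
      (fun t ht => by simp [h0 t ht, zA t ht.le, zD t ht.le])
      (by
        intro t ht
        constructor
        · rw [(he t ht).1, (esol t).1, add_sub_add_left_eq_sub, ← Finset.sum_sub_distrib]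
          exact Finset.sum_congr rfl fun k _ => by ring
        · rw [(he t ht).2, (esol t).2, add_sub_add_left_eq_sub, ← Finset.sum_sub_distrib]
          exact Finset.sum_congr rfl fun k _ => by ring) t
    exact ⟨sub_eq_zero.1 this.1, sub_eq_zero.1 this.2⟩
  constructor
  · refine ⟨(fun t => (A t + D t) / 2, fun t => (A t - D t) / 2), ⟨⟨by fun_prop, by fun_prop⟩, ?_, ?_⟩, ?_⟩
    · intro t ht
      simp [zA t ht.le, zD t ht.le]
    · intro t _
      exact esol t
    · rintro ⟨Z₁, Z₂⟩ ⟨-, h0, he⟩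
      have := huniq Z₁ Z₂ h0 he
      exact Prod.ext (funext fun t => (this t).1) (funext fun t => (this t).2)
  · intro Z₁ Z₂ _ _ h0 he t ht
    obtain ⟨e1, e2⟩ := huniq Z₁ Z₂ h0 he t
    have bA := est_lem τ hτ (zext gA) (hzn gA) (1 / J) (Pi₁ + Pi₂) hA2 _ hz3
      (fun t ht => (abs_add_le _ _).trans (by linarith [hb1 t ht, hb2 t ht])) (by positivity) t ht
    have bD := est_lem τ hτ (zext gD) (hzn gD) 0 (Pi₁ + Pi₂) hD2 _ hz4
      (fun t ht => (abs_sub _ _).trans (by linarith [hb1 t ht, hb2 t ht])) (by positivity) t ht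
    rw [← hA] at bA
    rw [← hD, zero_mul, sub_zero] at bD
    have hfac : 1 / (2 * J) = 1 / J / 2 := by field_simp
    rw [e1, e2, hfac, Pi.add_apply, mul_add]
    have nA := (abs_nonneg _).trans bA
    have nD := (abs_nonneg _).trans bD
    rw [abs_le] at bA bD
    constructor
    · rw [abs_le]; constructor <;> linarith [bA.1, bA.2, bD.1, bD.2]
    · rw [abs_le]; constructor <;> linarith [bA.1, bA.2, bD.1, bD.2]
end
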